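/- arXiv:1102.5019 — 2 statements merged into one kernel-verified Lean document; each statement's English description precedes it below -/
import Mathlib

section
/- Let 0 < p < 1 and n ∈ ℕ. For Bernoulli site percolation on the box [0,n]² of the triangular lattice, P_p(A_n) + P_{1−p}(A_n) = 1, where A_n is the event of an open left-right crossing of the box. -/
open MeasureTheory

abbrev Site := ℤ × ℤ
abbrev Config := Site → Bool

def triAdj (u v : Site) : Prop :=
  u - v ∈ ({(1, 0), (-1, 0), (0, 1), (0, -1), (1, 1), (-1, -1)} : Set Site)

def IsSitePercolation (q : Site → ℝ) (μ : Measure Config) : Prop :=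
  IsProbabilityMeasure μ ∧
  ∀ (S : Finset Site) (f : Site → Bool),
    μ {ω | ∀ v ∈ S, ω v = f v} =
      ∏ v ∈ S, if f v then ENNReal.ofReal (q v) else ENNReal.ofReal (1 - q v)

def IsBernoulliPercolation (p : ℝ) (μ : Measure Config) : Prop :=
  IsSitePercolation (fun _ => p) μ

def IsOpenPath (ω : Config) (l : List Site) : Prop :=
  l ≠ [] ∧ l.Chain' triAdj ∧ ∀ v ∈ l, ω v = true

def openCluster (ω : Config) (v : Site) : Set Site :=
  {w | ∃ l : List Site, IsOpenPath ω l ∧ l.head? = some v ∧ l.getLast? = some w}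

/-- The `N × N` screen `{0, …, N−1}²`. -/
def screen (N : ℕ) : Set Site :=
  {v | 0 ≤ v.1 ∧ v.1 < N ∧ 0 ≤ v.2 ∧ v.2 < N}

/-- The box `[0, n]² = {0, …, n} × {0, …, n}`. -/
def box (n : ℕ) : Set Site :=
  {v | 0 ≤ v.1 ∧ v.1 ≤ n ∧ 0 ≤ v.2 ∧ v.2 ≤ n}

/-- `S` is connected with respect to the triangular-lattice adjacency: any two
of its sites are joined by a path staying inside `S`. -/
def ConnectedIn (S : Set Site) : Prop :=
  ∀ u ∈ S, ∀ w ∈ S, ∃ l : List Site, l.head? = some u ∧ l.getLast? = some w ∧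
    l.Chain' triAdj ∧ ∀ v ∈ l, v ∈ S

/-- The event `F_N(n)`: the screen `{0, …, N−1}²` contains a connected set of at
least `n` open sites. -/
def ClusterEvent (N n : ℕ) : Set Config :=
  {ω | ∃ S : Finset Site, ↑S ⊆ screen N ∧ n ≤ S.card ∧ ConnectedIn ↑S ∧ ∀ v ∈ S, ω v = true}

/-- `l` is a left–right crossing of the box `[0, n]²` all of whose sites carry
the colour `b` (`true` = open/black, `false` = closed/white). -/
def IsLRCrossing (n : ℕ) (b : Bool) (ω : Config) (l : List Site) : Prop :=
  l.Chain' triAdj ∧ (∀ v ∈ l, v ∈ box n ∧ ω v = b) ∧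
  (∃ u, l.head? = some u ∧ u.1 = 0) ∧ (∃ w, l.getLast? = some w ∧ w.1 = n)

/-- `l` is a top–bottom crossing of the box `[0, n]²` all of whose sites carry
the colour `b`. -/
def IsTBCrossing (n : ℕ) (b : Bool) (ω : Config) (l : List Site) : Prop :=
  l.Chain' triAdj ∧ (∀ v ∈ l, v ∈ box n ∧ ω v = b) ∧
  (∃ u, l.head? = some u ∧ u.2 = n) ∧ (∃ w, l.getLast? = some w ∧ w.2 = 0)

/-- The event `A_n`: there is an open left–right crossing of the box `[0, n]²`. -/
def EventA (n : ℕ) : Set Config := {ω | ∃ l, IsLRCrossing n true ω l}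

/-- The event `B_n`: there is a closed top–bottom crossing of the box `[0, n]²`. -/
def EventB (n : ℕ) : Set Config := {ω | ∃ l, IsTBCrossing n false ω l}

/-- There exist `k` pairwise vertex-disjoint open left–right crossings of `[0, n]²`. -/
def HasDisjointCrossings (n : ℕ) (ω : Config) (k : ℕ) : Prop :=
  ∃ L : Fin k → List Site, (∀ i, IsLRCrossing n true ω (L i)) ∧
    ∀ i j, i ≠ j → ∀ v, v ∈ L i → v ∉ L j

/-- The critical probability for site percolation on the triangular lattice:
the supremum of those `p ∈ [0,1]` for which the open cluster of the origin is
almost surely finite. -/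
noncomputable def pcSite : ℝ :=
  sSup {p : ℝ | p ∈ Set.Icc (0 : ℝ) 1 ∧
    ∀ μ : Measure Config, IsBernoulliPercolation p μ →
      μ {ω | (openCluster ω (0, 0)).Infinite} = 0}


theorem exists_integer_potential (a b : ℕ) (d₁ d₂ : ℕ → ℕ → ℤ)
    (hd : ∀ i < a, ∀ j < b, d₁ i j + d₂ (i + 1) j = d₂ i j + d₁ i (j + 1)) (c : ℤ) :
    ∃ H : ℕ → ℕ → ℤ, H 0 0 = c ∧ (∀ i < a, ∀ j ≤ b, H (i + 1) j = H i j + d₁ i j) ∧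
      ∀ i ≤ a, ∀ j < b, H i (j + 1) = H i j + d₂ i j := by
  refine ⟨fun i j => c + ∑ k ∈ Finset.range i, d₁ k 0 + ∑ k ∈ Finset.range j, d₂ i k,
    by simp, ?_, ?_⟩
  · intro i hi j
    induction j with
    | zero => intro _; simp [Finset.sum_range_succ]; ring
    | succ j ih =>
      intro hj
      have h₁ := ih (by omega)
      have h₂ := hd i hi j (by omega)
      simp only [Finset.sum_range_succ] at h₁ ⊢
      linarith
  · intro i _ j _
    simp only [Finset.sum_range_succ]
    ring

/-- A labelling of a grid by residues modulo `M`, with unit increments of zero sum around every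
unit square, lifts to an integer-valued function. -/
theorem exists_integer_lift (M : ℤ) (a b : ℕ) (lab d₁ d₂ : ℕ → ℕ → ℤ)
    (h₁ : ∀ i < a, ∀ j ≤ b, |d₁ i j| ≤ 1 ∧ M ∣ lab (i + 1) j - lab i j - d₁ i j)
    (h₂ : ∀ i ≤ a, ∀ j < b, |d₂ i j| ≤ 1 ∧ M ∣ lab i (j + 1) - lab i j - d₂ i j)
    (hd : ∀ i < a, ∀ j < b, d₁ i j + d₂ (i + 1) j = d₂ i j + d₁ i (j + 1)) :
    ∃ H : ℕ → ℕ → ℤ, H 0 0 = lab 0 0 ∧ (∀ i ≤ a, ∀ j ≤ b, M ∣ H i j - lab i j) ∧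
      (∀ i < a, ∀ j ≤ b, |H (i + 1) j - H i j| ≤ 1) ∧
      ∀ i ≤ a, ∀ j < b, |H i (j + 1) - H i j| ≤ 1 := by
  obtain ⟨H, h0, hH₁, hH₂⟩ := exists_integer_potential a b d₁ d₂ hd (lab 0 0)
  refine ⟨H, h0, ?_, ?_, ?_⟩
  · intro i hi j
    induction j with
    | zero =>
      intro hj
      induction i with
      | zero => simp [h0]
      | succ i ih =>
        obtain ⟨x, hx⟩ := ih (by omega)
        obtain ⟨y, hy⟩ := (h₁ i (by omega) 0 hj).2
        exact ⟨x - y, by rw [hH₁ i (by omega) 0 hj, mul_sub, ← hx, ← hy]; ring⟩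
    | succ j ih =>
      intro hj
      obtain ⟨x, hx⟩ := ih (by omega)
      obtain ⟨y, hy⟩ := (h₂ i hi j (by omega)).2
      exact ⟨x - y, by rw [hH₂ i hi j (by omega), mul_sub, ← hx, ← hy]; ring⟩
  · intro i hi j hj
    rw [hH₁ i hi j hj, add_sub_cancel_left]
    exact (h₁ i hi j hj).1
  · intro i hi j hj
    rw [hH₂ i hi j hj, add_sub_cancel_left]
    exact (h₂ i hi j hj).1

/-- An integer walk with steps of size at most one which avoids `lo` and `hi` and starts strictly
between them stays strictly between them. -/
theorem unit_step_walk_confined {g : ℕ → ℤ} {m : ℕ} {lo hi : ℤ}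
    (hstep : ∀ k < m, |g (k + 1) - g k| ≤ 1) (havoid : ∀ k ≤ m, g k ≠ lo ∧ g k ≠ hi)
    (h0 : lo < g 0 ∧ g 0 < hi) : ∀ k ≤ m, lo < g k ∧ g k < hi := by
  intro k
  induction k with
  | zero => exact fun _ => h0
  | succ k ih =>
    intro hk
    have h₁ := ih (by omega)
    have h₂ := abs_le.1 (hstep k (by omega))
    have h₃ := havoid (k + 1) hk
    omega

theorem triAdj_iff {u v : Site} : triAdj u v ↔
    (u.1 - v.1 = 1 ∧ u.2 - v.2 = 0) ∨ (u.1 - v.1 = -1 ∧ u.2 - v.2 = 0) ∨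
    (u.1 - v.1 = 0 ∧ u.2 - v.2 = 1) ∨ (u.1 - v.1 = 0 ∧ u.2 - v.2 = -1) ∨
    (u.1 - v.1 = 1 ∧ u.2 - v.2 = 1) ∨ (u.1 - v.1 = -1 ∧ u.2 - v.2 = -1) := by
  simp [triAdj, Prod.ext_iff]

theorem triAdj_symm {u v : Site} (h : triAdj u v) : triAdj v u := by
  rw [triAdj_iff] at *
  omega

theorem triAdj_swap {u v : Site} (h : triAdj u v) : triAdj u.swap v.swap := by
  rw [triAdj_iff] at *
  simp only [Prod.fst_swap, Prod.snd_swap]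
  omega

/-- The configuration obtained by exchanging the two colours and the two coordinates. -/
def dualConfig (ω : Config) : Config := fun v => !ω v.swap

/-- `v` is joined to the left side of `[0, n]²` by an open path in the box. -/
def LeftReach (n : ℕ) (ω : Config) (v : Site) : Prop :=
  ∃ l : List Site, l.IsChain triAdj ∧ (∀ u ∈ l, u ∈ box n ∧ ω u = true) ∧
    (∃ u, l.head? = some u ∧ u.1 = 0) ∧ l.getLast? = some v

theorem leftReach_of_left {n : ℕ} {ω : Config} {v : Site} (hv : v ∈ box n) (ho : ω v = true)
    (h0 : v.1 = 0) : LeftReach n ω v :=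
  ⟨[v], List.isChain_singleton v, by simp [hv, ho], ⟨v, by simp, h0⟩, by simp⟩

theorem LeftReach.step {n : ℕ} {ω : Config} {u v : Site} (h : LeftReach n ω u)
    (huv : triAdj u v) (hv : v ∈ box n) (ho : ω v = true) : LeftReach n ω v := by
  obtain ⟨l, hc, hb, ⟨s, hs, hs0⟩, hl⟩ := h
  refine ⟨l ++ [v], ?_, ?_, ⟨s, by simp [hs], hs0⟩, by simp⟩
  · refine List.isChain_append.2 ⟨hc, by simp, ?_⟩
    intro x hx y hy
    rw [hl] at hx
    simp at hx hy
    subst hx hy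
    exact huv
  · intro w hw
    rcases List.mem_append.1 hw with hw | hw
    · exact hb w hw
    · rw [List.mem_singleton.1 hw]
      exact ⟨hv, ho⟩

theorem LeftReach.mem_eventA {n : ℕ} {ω : Config} {v : Site} (h : LeftReach n ω v)
    (hv : v.1 = n) : ω ∈ EventA n := by
  obtain ⟨l, hc, hb, hs, hl⟩ := h
  exact ⟨l, hc, hb, hs, v, hl, hv⟩

open Classical in
/-- The label of a site: `0` and `2` for open sites joined, respectively not joined, to the left
side by open sites; `1` and `3` likewise for closed sites and the bottom side. -/
noncomputable def siteLabel (n : ℕ) (ω : Config) (v : Site) : ℤ :=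
  if ω v = true then (if LeftReach n ω v then 0 else 2)
  else (if LeftReach n (dualConfig ω) v.swap then 1 else 3)

theorem siteLabel_range (n : ℕ) (ω : Config) (v : Site) :
    0 ≤ siteLabel n ω v ∧ siteLabel n ω v ≤ 3 := by
  unfold siteLabel
  split_ifs <;> norm_num

theorem swap_mem_box {n : ℕ} {v : Site} : v.swap ∈ box n ↔ v ∈ box n := by
  simp only [box, Set.mem_ofPred_eq, Prod.fst_swap, Prod.snd_swap]
  tauto

theorem exists_siteLabel_increment {n : ℕ} {ω : Config} {u v : Site} (huv : triAdj u v)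
    (hu : u ∈ box n) (hv : v ∈ box n) :
    ∃ e : ℤ, |e| ≤ 1 ∧ 4 ∣ siteLabel n ω v - siteLabel n ω u - e := by
  have key : ∀ x y : ℤ, 0 ≤ x → x ≤ 3 → 0 ≤ y → y ≤ 3 → y - x ≠ 2 → y - x ≠ -2 →
      ∃ e : ℤ, |e| ≤ 1 ∧ 4 ∣ y - x - e := by
    intro x y hx hx' hy hy' h h'
    rcases (by omega : 4 ∣ y - x - 0 ∨ 4 ∣ y - x - 1 ∨ 4 ∣ y - x - -1) with h | h | h
    exacts [⟨0, by norm_num, h⟩, ⟨1, by norm_num, h⟩, ⟨-1, by norm_num, h⟩]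
  have open_iff : ω u = true → ω v = true → (LeftReach n ω u ↔ LeftReach n ω v) :=
    fun h h' => ⟨fun r => r.step huv hv h', fun r => r.step (triAdj_symm huv) hu h⟩
  have closed_iff : ¬ω u = true → ¬ω v = true →
      (LeftReach n (dualConfig ω) u.swap ↔ LeftReach n (dualConfig ω) v.swap) :=
    fun h h' => ⟨fun r => r.step (triAdj_swap huv) (swap_mem_box.2 hv)
      (by simpa [dualConfig] using h'),
      fun r => r.step (triAdj_swap (triAdj_symm huv)) (swap_mem_box.2 hu)
        (by simpa [dualConfig] using h)⟩
  have hu' := siteLabel_range n ω u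
  have hv' := siteLabel_range n ω v
  apply key _ _ hu'.1 hu'.2 hv'.1 hv'.2 <;>
  · unfold siteLabel
    split_ifs <;> first | omega | tauto

theorem siteLabel_ne_two {n : ℕ} {ω : Config} {v : Site} (hv : v ∈ box n) (h : v.1 = 0) :
    siteLabel n ω v ≠ 2 := by
  unfold siteLabel
  split_ifs with h₁ h₂
  · norm_num
  · exact absurd (leftReach_of_left hv h₁ h) h₂
  · norm_num
  · norm_num

theorem siteLabel_ne_three {n : ℕ} {ω : Config} {v : Site} (hv : v ∈ box n) (h : v.2 = 0) :
    siteLabel n ω v ≠ 3 := by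
  unfold siteLabel
  split_ifs with h₁ h₂ h₂
  · norm_num
  · norm_num
  · norm_num
  · exact absurd (leftReach_of_left (swap_mem_box.2 hv) (by simpa [dualConfig] using h₁) h) h₂

theorem siteLabel_ne_zero {n : ℕ} {ω : Config} {v : Site} (hA : ω ∉ EventA n) (h : v.1 = n) :
    siteLabel n ω v ≠ 0 := by
  unfold siteLabel
  split_ifs with h₁ h₂
  · exact absurd (h₂.mem_eventA h) hA
  all_goals norm_num

theorem siteLabel_ne_one {n : ℕ} {ω : Config} {v : Site} (hA : dualConfig ω ∉ EventA n)
    (h : v.2 = n) : siteLabel n ω v ≠ 1 := by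
  unfold siteLabel
  split_ifs with h₁ h₂ h₂
  · norm_num
  · norm_num
  · exact absurd (h₂.mem_eventA h) hA
  · norm_num

theorem mem_eventA_or_dualConfig_mem_eventA (n : ℕ) (ω : Config) :
    ω ∈ EventA n ∨ dualConfig ω ∈ EventA n := by
  by_contra! hA
  obtain ⟨hA, hA'⟩ := hA
  set site : ℕ → ℕ → Site := fun i j => (i, j) with hsite
  have hbox : ∀ i ≤ n, ∀ j ≤ n, site i j ∈ box n := by
    intro i hi j hj
    simp only [box, hsite, Set.mem_ofPred_eq]
    omega
  have inc₁ : ∀ i j, ∃ e : ℤ, i < n → j ≤ n → |e| ≤ 1 ∧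
      4 ∣ siteLabel n ω (site (i + 1) j) - siteLabel n ω (site i j) - e := by
    intro i j
    by_cases h : i < n ∧ j ≤ n
    · obtain ⟨e, he⟩ := exists_siteLabel_increment (ω := ω) (u := site i j) (v := site (i + 1) j)
        (by simp [triAdj_iff, hsite]) (hbox _ (by omega) _ h.2) (hbox _ (by omega) _ h.2)
      exact ⟨e, fun _ _ => he⟩
    · exact ⟨0, fun h₁ h₂ => absurd ⟨h₁, h₂⟩ h⟩
  have inc₂ : ∀ i j, ∃ e : ℤ, i ≤ n → j < n → |e| ≤ 1 ∧
      4 ∣ siteLabel n ω (site i (j + 1)) - siteLabel n ω (site i j) - e := by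
    intro i j
    by_cases h : i ≤ n ∧ j < n
    · obtain ⟨e, he⟩ := exists_siteLabel_increment (ω := ω) (u := site i j) (v := site i (j + 1))
        (by simp [triAdj_iff, hsite]) (hbox _ h.1 _ (by omega)) (hbox _ h.1 _ (by omega))
      exact ⟨e, fun _ _ => he⟩
    · exact ⟨0, fun h₁ h₂ => absurd ⟨h₁, h₂⟩ h⟩
  choose d₁ hd₁ using inc₁
  choose d₂ hd₂ using inc₂
  obtain ⟨H, h0, hmod, hs₁, hs₂⟩ := exists_integer_lift 4 n n (fun i j => siteLabel n ω (site i j))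
    d₁ d₂ (fun i hi j hj => hd₁ i j hi hj) (fun i hi j hj => hd₂ i j hi hj) (by
      intro i hi j hj
      obtain ⟨e, he, hdvd⟩ := exists_siteLabel_increment (ω := ω) (u := site i j)
        (v := site (i + 1) (j + 1)) (by simp [triAdj_iff, hsite])
        (hbox _ (by omega) _ (by omega)) (hbox _ (by omega) _ (by omega))
      have e₁ := hd₁ i j hi hj.le
      have e₂ := hd₂ i j hi.le hj
      have e₃ := hd₁ i (j + 1) hi hj
      have e₄ := hd₂ (i + 1) j hi hj
      rw [abs_le] at he e₁ e₂ e₃ e₄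
      omega)
  have range := fun i j => siteLabel_range n ω (site i j)
  have left : ∀ j ≤ n, siteLabel n ω (site 0 j) ≠ 2 := fun j hj =>
    siteLabel_ne_two (hbox 0 (by omega) j hj) rfl
  have bottom : ∀ i ≤ n, siteLabel n ω (site i 0) ≠ 3 := fun i hi =>
    siteLabel_ne_three (hbox i hi 0 (by omega)) rfl
  have right : ∀ j, siteLabel n ω (site n j) ≠ 0 := fun j => siteLabel_ne_zero hA rfl
  have top : ∀ i, siteLabel n ω (site i n) ≠ 1 := fun i => siteLabel_ne_one hA' rfl
  have c₀₀ := left 0 (by omega)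
  have c₀₀' := bottom 0 (by omega)
  have r₀₀ := range 0 0
  have w₁ := unit_step_walk_confined (g := fun i => H i 0) (m := n) (lo := -1) (hi := 3)
    (fun i hi => hs₁ i hi 0 (by omega))
    (fun i hi => by
      have := hmod i hi 0 (by omega)
      have := bottom i hi
      have := range i 0
      omega) (by omega) n le_rfl
  have m₁ := hmod n le_rfl 0 (by omega)
  have w₂ := unit_step_walk_confined (g := fun j => H n j) (m := n) (lo := 0) (hi := 4)
    (fun j hj => hs₂ n le_rfl j hj)
    (fun j hj => by
      have := hmod n le_rfl j hj
      have := right j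
      have := range n j
      omega)
    (by
      have := right 0
      have := range n 0
      omega) n le_rfl
  have w₃ := unit_step_walk_confined (g := fun j => H 0 j) (m := n) (lo := -2) (hi := 2)
    (fun j hj => hs₂ 0 (by omega) j hj)
    (fun j hj => by
      have := hmod 0 (by omega) j hj
      have := left j hj
      have := range 0 j
      omega) (by omega) n le_rfl
  have m₃ := hmod 0 (by omega) n le_rfl
  have w₄ := unit_step_walk_confined (g := fun i => H i n) (m := n) (lo := -3) (hi := 1)
    (fun i hi => hs₁ i hi n le_rfl)
    (fun i hi => by
      have := hmod i hi n le_rfl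
      have := top i
      have := range i n
      omega)
    (by
      have := left n le_rfl
      have := top 0
      have := range 0 n
      omega) n le_rfl
  have m₄ := hmod n le_rfl n le_rfl
  have := right n
  have := top n
  have := range n n
  omega

/-- The index of the half-open sector, between consecutive directions of the triangular lattice,
which contains a nonzero vector. -/
def sector (v : Site) : ℤ :=
  if 0 < v.2 then (if v.1 ≤ 0 then 2 else if v.1 ≤ v.2 then 1 else 0)
  else if v.2 = 0 then (if 0 < v.1 then 0 else 3)
  else if 0 ≤ v.1 then 5 else if v.2 ≤ v.1 then 4 else 3

theorem exists_sector_increment {u v : Site} (hu : u ≠ 0) (hv : v ≠ 0) (huv : triAdj u v) :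
    ∃ e : ℤ, |e| ≤ 1 ∧ 6 ∣ sector v - sector u - e := by
  have hu' : ¬(u.1 = 0 ∧ u.2 = 0) := fun h => hu (Prod.ext h.1 h.2)
  have hv' : ¬(v.1 = 0 ∧ v.2 = 0) := fun h => hv (Prod.ext h.1 h.2)
  rw [triAdj_iff] at huv
  have : 6 ∣ sector v - sector u - 0 ∨ 6 ∣ sector v - sector u - 1 ∨
      6 ∣ sector v - sector u - -1 := by
    unfold sector
    split_ifs <;> omega
  rcases this with h | h | h
  exacts [⟨0, by norm_num, h⟩, ⟨1, by norm_num, h⟩, ⟨-1, by norm_num, h⟩]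

theorem exists_crossing_walk {n : ℕ} {ω : Config} (h : ω ∈ EventA n) :
    ∃ (a : ℕ) (γ : ℕ → Site), (γ 0).1 = 0 ∧ (γ a).1 = n ∧
      (∀ i < a, triAdj (γ i) (γ (i + 1))) ∧ ∀ i ≤ a, γ i ∈ box n ∧ ω (γ i) = true := by
  obtain ⟨l, hc, hb, ⟨u, hu, hu0⟩, w, hw, hwn⟩ := h
  have hpos : 0 < l.length := by
    rcases l with _ | _
    · simp at hu
    · simp
  have hget : ∀ i (hi : i < l.length), l.getD i 0 = l[i] := fun i hi => by simp [hi]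
  refine ⟨l.length - 1, fun i => l.getD i 0, ?_, ?_, ?_, ?_⟩
  · rw [List.head?_eq_getElem?] at hu
    simp [List.getD, hu, hu0]
  · rw [List.getLast?_eq_getElem?] at hw
    simp [List.getD, hw, hwn]
  · intro i hi
    dsimp only
    rw [hget i (by omega), hget (i + 1) (by omega)]
    exact List.isChain_iff_getElem.1 hc i (by omega)
  · intro i hi
    dsimp only
    rw [hget i (by omega)]
    exact hb _ (List.getElem_mem _)

theorem not_mem_eventA_and_dualConfig_mem_eventA (n : ℕ) (ω : Config) :
    ¬(ω ∈ EventA n ∧ dualConfig ω ∈ EventA n) := by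
  rintro ⟨h, h'⟩
  obtain ⟨a, γ, γ0, γa, hγ, hγb⟩ := exists_crossing_walk h
  obtain ⟨b, δ, δ0, δb, hδ, hδb⟩ := exists_crossing_walk h'
  set D : ℕ → ℕ → Site := fun i j => γ i - (δ j).swap with hD
  have hne : ∀ i ≤ a, ∀ j ≤ b, D i j ≠ 0 := by
    intro i hi j hj h0
    have h₁ := (hγb i hi).2
    have h₂ := (hδb j hj).2
    rw [sub_eq_zero.1 h0] at h₁
    simp [dualConfig, h₁] at h₂
  have inc₁ : ∀ i j, ∃ e : ℤ, i < a → j ≤ b → |e| ≤ 1 ∧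
      6 ∣ sector (D (i + 1) j) - sector (D i j) - e := by
    intro i j
    by_cases h : i < a ∧ j ≤ b
    · obtain ⟨e, he⟩ := exists_sector_increment (hne i (by omega) j h.2) (hne (i + 1) h.1 j h.2) (by
        have := hγ i h.1
        rw [triAdj_iff] at this ⊢
        simp only [hD, Prod.fst_sub, Prod.snd_sub]
        omega)
      exact ⟨e, fun _ _ => he⟩
    · exact ⟨0, fun h₁ h₂ => absurd ⟨h₁, h₂⟩ h⟩
  have inc₂ : ∀ i j, ∃ e : ℤ, i ≤ a → j < b → |e| ≤ 1 ∧
      6 ∣ sector (D i (j + 1)) - sector (D i j) - e := by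
    intro i j
    by_cases h : i ≤ a ∧ j < b
    · obtain ⟨e, he⟩ := exists_sector_increment (hne i h.1 j (by omega)) (hne i h.1 (j + 1) h.2) (by
        have := hδ j h.2
        rw [triAdj_iff] at this ⊢
        simp only [hD, Prod.fst_sub, Prod.snd_sub, Prod.fst_swap, Prod.snd_swap]
        omega)
      exact ⟨e, fun _ _ => he⟩
    · exact ⟨0, fun h₁ h₂ => absurd ⟨h₁, h₂⟩ h⟩
  choose d₁ hd₁ using inc₁
  choose d₂ hd₂ using inc₂
  obtain ⟨H, h0, hmod, hs₁, hs₂⟩ := exists_integer_lift 6 a b (fun i j => sector (D i j))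
    d₁ d₂ (fun i hi j hj => hd₁ i j hi hj) (fun i hi j hj => hd₂ i j hi hj) (by
      intro i hi j hj
      have e₁ := hd₁ i j hi hj.le
      have e₂ := hd₂ i j hi.le hj
      have e₃ := hd₁ i (j + 1) hi hj
      have e₄ := hd₂ (i + 1) j hi hj
      rw [abs_le] at e₁ e₂ e₃ e₄
      omega)
  have nonzero : ∀ i ≤ a, ∀ j ≤ b, ¬((D i j).1 = 0 ∧ (D i j).2 = 0) := fun i hi j hj h =>
    hne i hi j hj (Prod.ext h.1 h.2)
  have left : ∀ j ≤ b, (D 0 j).1 ≤ 0 := fun j hj => by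
    have := (hδb j hj).1
    simp only [box, Set.mem_ofPred_eq] at this
    simp only [hD, Prod.fst_sub, Prod.fst_swap]
    omega
  have right : ∀ j ≤ b, 0 ≤ (D a j).1 := fun j hj => by
    have := (hδb j hj).1
    simp only [box, Set.mem_ofPred_eq] at this
    simp only [hD, Prod.fst_sub, Prod.fst_swap]
    omega
  have above : ∀ i ≤ a, 0 ≤ (D i 0).2 := fun i hi => by
    have := (hγb i hi).1
    simp only [box, Set.mem_ofPred_eq] at this
    simp only [hD, Prod.snd_sub, Prod.snd_swap]
    omega
  have below : ∀ i ≤ a, (D i b).2 ≤ 0 := fun i hi => by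
    have := (hγb i hi).1
    simp only [box, Set.mem_ofPred_eq] at this
    simp only [hD, Prod.snd_sub, Prod.snd_swap]
    omega
  have sec_left : ∀ v : Site, ¬(v.1 = 0 ∧ v.2 = 0) → v.1 ≤ 0 → 2 ≤ sector v ∧ sector v ≤ 5 := by
    intro v h₁ h₂
    unfold sector
    split_ifs <;> omega
  have sec_right : ∀ v : Site, ¬(v.1 = 0 ∧ v.2 = 0) → 0 ≤ v.1 →
      0 ≤ sector v ∧ sector v ≤ 5 ∧ sector v ≠ 3 ∧ sector v ≠ 4 := by
    intro v h₁ h₂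
    unfold sector
    split_ifs <;> omega
  have sec_above : ∀ v : Site, ¬(v.1 = 0 ∧ v.2 = 0) → 0 ≤ v.2 →
      0 ≤ sector v ∧ sector v ≤ 3 := by
    intro v h₁ h₂
    unfold sector
    split_ifs <;> omega
  have sec_below : ∀ v : Site, ¬(v.1 = 0 ∧ v.2 = 0) → v.2 ≤ 0 →
      0 ≤ sector v ∧ sector v ≤ 5 ∧ sector v ≠ 1 ∧ sector v ≠ 2 := by
    intro v h₁ h₂
    unfold sector
    split_ifs <;> omega
  have sl := fun j hj => sec_left _ (nonzero 0 (by omega) j hj) (left j hj)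
  have sr := fun j hj => sec_right _ (nonzero a le_rfl j hj) (right j hj)
  have sa := fun i hi => sec_above _ (nonzero i hi 0 (by omega)) (above i hi)
  have sb := fun i hi => sec_below _ (nonzero i hi b le_rfl) (below i hi)
  have l₀ := sl 0 (by omega)
  have a₀ := sa 0 (by omega)
  have w₁ := unit_step_walk_confined (g := fun i => H i 0) (m := a) (lo := -1) (hi := 4)
    (fun i hi => hs₁ i hi 0 (by omega))
    (fun i hi => by
      have := hmod i hi 0 (by omega)
      have := sa i hi
      omega) (by omega) a le_rfl
  have m₁ := hmod a le_rfl 0 (by omega)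
  have r₀ := sr 0 (by omega)
  have a₁ := sa a le_rfl
  have w₂ := unit_step_walk_confined (g := fun j => H a j) (m := b) (lo := -2) (hi := 3)
    (fun j hj => hs₂ a le_rfl j hj)
    (fun j hj => by
      have := hmod a le_rfl j hj
      have := sr j hj
      omega) (by omega) b le_rfl
  have w₃ := unit_step_walk_confined (g := fun j => H 0 j) (m := b) (lo := 1) (hi := 6)
    (fun j hj => hs₂ 0 (by omega) j hj)
    (fun j hj => by
      have := hmod 0 (by omega) j hj
      have := sl j hj
      omega) (by omega) b le_rfl
  have m₃ := hmod 0 (by omega) b le_rfl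
  have l₁ := sl b le_rfl
  have b₀ := sb 0 (by omega)
  have w₄ := unit_step_walk_confined (g := fun i => H i b) (m := a) (lo := 2) (hi := 7)
    (fun i hi => hs₁ i hi b le_rfl)
    (fun i hi => by
      have := hmod i hi b le_rfl
      have := sb i hi
      omega) (by omega) a le_rfl
  have m₄ := hmod a le_rfl b le_rfl
  have r₁ := sr b le_rfl
  have b₁ := sb a le_rfl
  omega

theorem dualConfig_mem_eventA_iff (n : ℕ) (ω : Config) :
    dualConfig ω ∈ EventA n ↔ ω ∉ EventA n := by
  have h₁ := mem_eventA_or_dualConfig_mem_eventA n ω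
  have h₂ := not_mem_eventA_and_dualConfig_mem_eventA n ω
  tauto

theorem measurable_dualConfig : Measurable dualConfig :=
  measurable_pi_lambda _ fun v => (measurable_of_finite Bool.not).comp (measurable_pi_apply v.swap)

theorem measurableSet_eventA (n : ℕ) : MeasurableSet (EventA n) := by
  have : EventA n = ⋃ l : List Site, {ω | IsLRCrossing n true ω l} := by
    ext ω
    simp [EventA]
  rw [this]
  refine MeasurableSet.iUnion fun l => ?_
  have hopen : MeasurableSet {ω : Config | ∀ v ∈ l, v ∈ box n ∧ ω v = true} := by
    simp only [Set.ofPred_forall]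
    refine MeasurableSet.iInter fun v => MeasurableSet.iInter fun _ => ?_
    exact (MeasurableSet.const _).inter
      (measurableSet_eq_fun (measurable_pi_apply v) measurable_const)
  exact (MeasurableSet.const _).inter
    (hopen.inter ((MeasurableSet.const _).inter (MeasurableSet.const _)))

theorem IsSitePercolation.measure_unique {q : Site → ℝ} {μ ν : Measure Config}
    (hμ : IsSitePercolation q μ) (hν : IsSitePercolation q ν) : μ = ν := by
  have := hμ.1
  have := hν.1
  refine IsProjectiveLimit.unique (P := fun S : Finset Site => μ.map S.restrict)
    (fun S => rfl) fun S => ?_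
  have cylinder : ∀ f : S → Bool, (S.restrict : Config → S → Bool) ⁻¹' {f} =
      {ω : Config | ∀ v ∈ S, ω v = (fun u => if h : u ∈ S then f ⟨u, h⟩ else true) v} := by
    intro f
    ext ω
    simp only [Set.mem_preimage, Set.mem_singleton_iff, Set.mem_ofPred_eq, funext_iff,
      Subtype.forall, Finset.restrict]
    exact forall₂_congr fun v hv => by simp [hv]
  refine Measure.ext_of_singleton fun f => ?_
  rw [Measure.map_apply (Finset.measurable_restrict S) (measurableSet_singleton f),
    Measure.map_apply (Finset.measurable_restrict S) (measurableSet_singleton f), cylinder,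
    hμ.2, hν.2]

theorem IsBernoulliPercolation.map_dualConfig {p : ℝ} {μ : Measure Config}
    (hμ : IsBernoulliPercolation p μ) :
    IsBernoulliPercolation (1 - p) (μ.map dualConfig) := by
  have := hμ.1
  refine ⟨Measure.isProbabilityMeasure_map measurable_dualConfig.aemeasurable, fun S f => ?_⟩
  have hmeas : MeasurableSet {ω : Config | ∀ v ∈ S, ω v = f v} := by
    simp only [Set.ofPred_forall]
    exact MeasurableSet.iInter fun v => MeasurableSet.iInter fun _ =>
      measurableSet_eq_fun (measurable_pi_apply v) measurable_const
  have hpre : dualConfig ⁻¹' {ω | ∀ v ∈ S, ω v = f v} =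
      {ω | ∀ v ∈ S.map (Equiv.prodComm ℤ ℤ).toEmbedding, ω v = (fun u => !f u.swap) v} := by
    ext ω
    simp only [Set.mem_preimage, Set.mem_ofPred_eq, Finset.forall_mem_map, dualConfig]
    refine forall₂_congr fun v _ => ?_
    simp [Bool.not_eq_eq_eq_not]
  rw [Measure.map_apply measurable_dualConfig hmeas, hpre, hμ.2, Finset.prod_map]
  refine Finset.prod_congr rfl fun v _ => ?_
  cases h : f v <;> simp [h]

/-- Lemma, part 3: `P_p(A_n) + P_{1−p}(A_n) = 1` for open left–right crossings
of the box `[0, n]²` of the triangular lattice. -/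
theorem crossing_self_duality (p : ℝ) (hp0 : 0 < p) (hp1 : p < 1) (n : ℕ)
    (μ ν : Measure Config) (hμ : IsBernoulliPercolation p μ)
    (hν : IsBernoulliPercolation (1 - p) ν) :
    μ (EventA n) + ν (EventA n) = 1 := by
  have := hμ.1
  rw [IsSitePercolation.measure_unique hν hμ.map_dualConfig,
    Measure.map_apply measurable_dualConfig (measurableSet_eventA n)]
  have : dualConfig ⁻¹' EventA n = (EventA n)ᶜ := Set.ext (dualConfig_mem_eventA_iff n)
  rw [this, prob_add_prob_compl (measurableSet_eventA n)]
end

section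
/- Consider Bernoulli site percolation on the triangular lattice 𝕋² with parameter p > 1/2 (supercritical, since p_c^site(𝕋²) = 1/2). There exist constants C₅ = C₅(p) > 0, C₆ = C₆(p) > 0 and N₁(p) ∈ ℕ such that for all n ≥ N₁(p), P_p(M_n ≤ C₅·n) ≤ e^{−C₆·n}, where M_n is the maximal number of pairwise vertex-disjoint open left-right crossings of the box [0,n]². -/
open MeasureTheory

namespace TriPerc

open Function Finset

/-! ### Finite-volume expectations -/

/-- The configuration whose open sites are exactly the elements of `B`. -/
def cfg (B : Finset Site) : Config := fun v => decide (v ∈ B)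

/-- Expectation of `f` under Bernoulli percolation of density `p` on the sites of `Λ`, all other
sites being closed. -/
noncomputable def Ex (p : ℝ) (Λ : Finset Site) (f : Config → ℝ) : ℝ :=
  ∑ B ∈ Λ.powerset, (∏ v ∈ Λ, if v ∈ B then p else 1 - p) * f (cfg B)

lemma cfg_insert (B : Finset Site) (v : Site) : cfg (insert v B) = update (cfg B) v true := by
  funext w
  by_cases h : w = v
  · subst h; simp [cfg]
  · simp [cfg, h]

lemma cfg_of_notMem {B : Finset Site} {v : Site} (h : v ∉ B) :
    cfg B = update (cfg B) v false := by
  funext w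
  by_cases hw : w = v
  · subst hw; simp [cfg, h]
  · simp [hw]

lemma Ex_empty (p : ℝ) (f : Config → ℝ) : Ex p ∅ f = f (cfg ∅) := by simp [Ex]

lemma Ex_insert (p : ℝ) {Λ : Finset Site} {v : Site} (hv : v ∉ Λ) (f : Config → ℝ) :
    Ex p (insert v Λ) f = p * Ex p Λ (fun ω => f (update ω v true)) +
      (1 - p) * Ex p Λ (fun ω => f (update ω v false)) := by
  unfold Ex
  rw [Finset.sum_powerset_insert hv, add_comm, Finset.mul_sum, Finset.mul_sum]
  congr 1
  · refine Finset.sum_congr rfl fun B hB => ?_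
    rw [Finset.prod_insert hv, if_pos (Finset.mem_insert_self _ _), cfg_insert, mul_assoc]
    congr 2
    refine Finset.prod_congr rfl fun w hw => ?_
    have : w ≠ v := fun h => hv (h ▸ hw)
    simp [this]
  · refine Finset.sum_congr rfl fun B hB => ?_
    have hvB : v ∉ B := fun h => hv (Finset.mem_powerset.1 hB h)
    simp only [← cfg_of_notMem hvB]
    rw [Finset.prod_insert hv, if_neg hvB, mul_assoc]

lemma Ex_add (p : ℝ) (Λ : Finset Site) (f g : Config → ℝ) :
    Ex p Λ (fun ω => f ω + g ω) = Ex p Λ f + Ex p Λ g := by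
  simp [Ex, mul_add, Finset.sum_add_distrib]

lemma Ex_sub (p : ℝ) (Λ : Finset Site) (f g : Config → ℝ) :
    Ex p Λ (fun ω => f ω - g ω) = Ex p Λ f - Ex p Λ g := by
  simp [Ex, mul_sub, Finset.sum_sub_distrib]

lemma Ex_sum (p : ℝ) (Λ : Finset Site) {ι : Type*} (s : Finset ι) (f : ι → Config → ℝ) :
    Ex p Λ (fun ω => ∑ i ∈ s, f i ω) = ∑ i ∈ s, Ex p Λ (f i) := by
  simp only [Ex, Finset.mul_sum]
  exact Finset.sum_comm

lemma Ex_const (p : ℝ) (Λ : Finset Site) (c : ℝ) : Ex p Λ (fun _ => c) = c := by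
  induction Λ using Finset.induction_on with
  | empty => simp [Ex_empty]
  | insert v Λ hv ih => rw [Ex_insert p hv, ih]; ring

section unitInterval

variable {p : ℝ} (hp0 : 0 ≤ p) (hp1 : p ≤ 1)
include hp0 hp1

lemma Ex_mono (Λ : Finset Site) {f g : Config → ℝ} (h : ∀ ω, f ω ≤ g ω) :
    Ex p Λ f ≤ Ex p Λ g := by
  refine Finset.sum_le_sum fun B _ => mul_le_mul_of_nonneg_left (h _) ?_
  refine Finset.prod_nonneg fun v _ => ?_
  split_ifs <;> linarith

lemma Ex_nonneg (Λ : Finset Site) {f : Config → ℝ} (h : ∀ ω, 0 ≤ f ω) : 0 ≤ Ex p Λ f := by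
  simpa [Ex_const] using Ex_mono hp0 hp1 Λ (f := fun _ => 0) h

/-- Harris' inequality. -/
lemma Ex_harris (Λ : Finset Site) {f g : Config → ℝ} (hf : Monotone f) (hg : Monotone g) :
    Ex p Λ f * Ex p Λ g ≤ Ex p Λ (fun ω => f ω * g ω) := by
  induction Λ using Finset.induction_on generalizing f g with
  | empty => simp [Ex_empty]
  | insert v Λ hv ih =>
    have up : ∀ b, Monotone fun ω : Config => update ω v b := fun b ω ω' h =>
      update_le_update_iff.2 ⟨le_rfl, fun w _ => h w⟩
    have hle : ∀ ω : Config, update ω v false ≤ update ω v true := fun ω =>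
      update_le_update_iff.2 ⟨by decide, fun w _ => le_rfl⟩
    rw [Ex_insert p hv, Ex_insert p hv, Ex_insert p hv]
    have h1 := ih (hf.comp (up true)) (hg.comp (up true))
    have h0 := ih (hf.comp (up false)) (hg.comp (up false))
    have hf' := Ex_mono hp0 hp1 Λ (f := fun ω => f (update ω v false))
      (g := fun ω => f (update ω v true)) (fun ω => hf (hle ω))
    have hg' := Ex_mono hp0 hp1 Λ (f := fun ω => g (update ω v false))
      (g := fun ω => g (update ω v true)) (fun ω => hg (hle ω))
    simp only [Function.comp_def] at h1 h0
    have e : 0 ≤ p * (1 - p) := mul_nonneg hp0 (by linarith)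
    have k := mul_nonneg e (mul_nonneg (sub_nonneg.2 hf') (sub_nonneg.2 hg'))
    nlinarith [mul_le_mul_of_nonneg_left h1 hp0,
      mul_le_mul_of_nonneg_left h0 (sub_nonneg.2 hp1)]

end unitInterval

lemma dependsOn_update {β : Type*} {f : Config → β} {S : Set Site} (hf : DependsOn f S)
    (v : Site) (b : Bool) : DependsOn (fun ω => f (update ω v b)) S := by
  intro ω ω' h
  refine hf fun w hw => ?_
  by_cases hwv : w = v
  · subst hwv; simp
  · simp [hwv, h w hw]

lemma dependsOn_update_of_notMem {β : Type*} {f : Config → β} {S : Set Site} (hf : DependsOn f S)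
    {v : Site} (hv : v ∉ S) (b : Bool) (ω : Config) : f (update ω v b) = f ω :=
  hf fun w hw => update_of_ne (fun h => hv (by rwa [← h])) _ _

/-- Functions of disjoint sets of sites are independent. -/
lemma Ex_mul_of_disjoint (p : ℝ) (Λ : Finset Site) {f g : Config → ℝ} {S T : Set Site}
    (hf : DependsOn f S) (hg : DependsOn g T) (hST : Disjoint S T) :
    Ex p Λ (fun ω => f ω * g ω) = Ex p Λ f * Ex p Λ g := by
  induction Λ using Finset.induction_on generalizing f g with
  | empty => simp [Ex_empty]
  | insert v Λ hv ih =>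
    rw [Ex_insert p hv, Ex_insert p hv, Ex_insert p hv,
      ih (dependsOn_update hf v true) (dependsOn_update hg v true),
      ih (dependsOn_update hf v false) (dependsOn_update hg v false)]
    by_cases hvS : v ∈ S
    · have hvT : v ∉ T := Set.disjoint_left.1 hST hvS
      simp only [dependsOn_update_of_notMem hg hvT]
      ring
    · simp only [dependsOn_update_of_notMem hf hvS]
      ring

lemma Ex_congr_of_subset (p : ℝ) {Λ Λ' : Finset Site} (hΛ : Λ ⊆ Λ') {f : Config → ℝ}
    (hf : DependsOn f (Λ : Set Site)) : Ex p Λ' f = Ex p Λ f := by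
  have key : ∀ Δ : Finset Site, Disjoint Λ Δ → Ex p (Λ ∪ Δ) f = Ex p Λ f := by
    intro Δ
    induction Δ using Finset.induction_on with
    | empty => simp
    | insert v Δ hv ih =>
      intro hd
      rw [Finset.disjoint_insert_right] at hd
      have hv' : v ∉ Λ ∪ Δ := by simp [hd.1, hv]
      rw [Finset.union_insert, Ex_insert p hv']
      have hvS : v ∉ (Λ : Set Site) := by simpa using hd.1
      simp only [dependsOn_update_of_notMem hf hvS]
      have e : Ex p (Λ ∪ Δ) (fun ω => f ω) = Ex p Λ f := ih hd.2
      rw [e]; ring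
  have := key (Λ' \ Λ) Finset.disjoint_sdiff
  rwa [Finset.union_sdiff_of_subset hΛ] at this

/-- Russo's formula. -/
lemma Ex_hasDerivAt (p : ℝ) (Λ : Finset Site) (f : Config → ℝ) :
    HasDerivAt (fun p => Ex p Λ f)
      (∑ v ∈ Λ, Ex p Λ (fun ω => f (update ω v true) - f (update ω v false))) p := by
  induction Λ using Finset.induction_on generalizing f with
  | empty => simpa [Ex_empty] using hasDerivAt_const p (f (cfg ∅))
  | insert v Λ hv ih =>
    have h1 := (hasDerivAt_id p).mul (ih (fun ω => f (update ω v true)))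
    have h0 := ((hasDerivAt_id p).const_sub 1).mul (ih (fun ω => f (update ω v false)))
    have h := h1.add h0
    have e : (fun p => Ex p (insert v Λ) f) =
        (id * fun p => Ex p Λ fun ω => f (update ω v true)) +
          ((fun x => 1 - id x) * fun p => Ex p Λ fun ω => f (update ω v false)) := by
      funext p
      simp [Ex_insert p hv]
    rw [e]
    refine h.congr_deriv ?_
    symm
    rw [Finset.sum_insert hv]
    simp only [Ex_sub, Finset.sum_sub_distrib, id]
    have hw : ∀ w ∈ Λ, ∀ b b' : Bool, ∀ ω : Config,
        update (update ω v b) w b' = update (update ω w b') v b := fun w hw b b' ω =>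
      update_comm (fun h : v = w => hv (by rwa [h])) _ _ _
    have e1 : ∀ b, ∑ w ∈ Λ, Ex p (insert v Λ) (fun ω => f (update ω w b)) =
        p * ∑ w ∈ Λ, Ex p Λ (fun ω => f (update (update ω w b) v true)) +
        (1 - p) * ∑ w ∈ Λ, Ex p Λ (fun ω => f (update (update ω w b) v false)) := by
      intro b
      rw [Finset.mul_sum, Finset.mul_sum, ← Finset.sum_add_distrib]
      refine Finset.sum_congr rfl fun w hwΛ => ?_
      rw [Ex_insert p hv]
      simp only [hw w hwΛ]
    have e2 : ∀ b, Ex p (insert v Λ) (fun ω => f (update ω v b)) =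
        Ex p Λ (fun ω => f (update ω v b)) := by
      intro b
      rw [Ex_insert p hv]
      simp only [update_idem]
      ring
    have e3 : ∀ b b', ∑ w ∈ Λ, Ex p Λ (fun ω => f (update (update ω w b) v b')) =
        ∑ w ∈ Λ, Ex p Λ (fun ω => f (update (update ω v b') w b)) := fun b b' =>
      Finset.sum_congr rfl fun w hwΛ => by simp only [hw w hwΛ]
    rw [e1, e1, e2, e2]
    simp only [e3]
    ring

/-- Symmetries of the site set. -/
lemma Ex_map (p : ℝ) (e : Site ≃ Site) (Λ : Finset Site) (f : Config → ℝ) :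
    Ex p (Λ.map e.toEmbedding) f = Ex p Λ (fun ω => f (ω ∘ e.symm)) := by
  induction Λ using Finset.induction_on generalizing f with
  | empty =>
    simp only [Finset.map_empty, Ex_empty]
    congr 1
  | insert v Λ hv ih =>
    have hv' : e.toEmbedding v ∉ Λ.map e.toEmbedding := by simpa using hv
    rw [Finset.map_insert, Ex_insert p hv', Ex_insert p hv, ih, ih]
    have : ∀ (ω : Config) b, update (ω ∘ e.symm) (e v) b = update ω v b ∘ e.symm := by
      intro ω b
      funext w
      by_cases h : e.symm w = v
      · have : w = e v := by rw [← h]; simp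
        subst this; simp
      · have : w ≠ e v := fun hw => h (by simp [hw])
        simp [this, h]
    simp only [Equiv.coe_toEmbedding, this]

/-- Exchanging the two colours. -/
lemma Ex_flip (p : ℝ) (Λ : Finset Site) {f : Config → ℝ} (hf : DependsOn f (Λ : Set Site)) :
    Ex p Λ (fun ω => f (fun v => !ω v)) = Ex (1 - p) Λ f := by
  have key : ∀ Δ : Finset Site, ∀ f : Config → ℝ, DependsOn f (Δ : Set Site) →
      Ex p Δ (fun ω => f (fun v => !ω v)) = Ex (1 - p) Δ f := by
    intro Δ
    induction Δ using Finset.induction_on with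
    | empty =>
      intro f hf
      simp only [Ex_empty]
      exact hf (by simp)
    | insert v Δ hv ih =>
      intro f hf
      have hd : ∀ b, DependsOn (fun ω => f (update ω v b)) (Δ : Set Site) := by
        intro b ω ω' h
        refine hf fun w hw => ?_
        by_cases hwv : w = v
        · subst hwv; simp
        · have : w ∈ (Δ : Set Site) := by
            simpa [hwv] using hw
          simp [hwv, h w this]
      have e : ∀ (ω : Config) b,
          (fun w => !(update ω v b w)) = update (fun w => !ω w) v (!b) := by
        intro ω b
        funext w
        by_cases hwv : w = v
        · subst hwv; simp
        · simp [hwv]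
      rw [Ex_insert _ hv, Ex_insert _ hv, ← ih _ (hd true), ← ih _ (hd false)]
      simp only [e, Bool.not_true, Bool.not_false]
      ring
  exact key Λ f hf

/-- Sprinkling: the union of two independent percolations is a percolation. -/
lemma Ex_sprinkle (s k : ℝ) (Λ : Finset Site) (f : Config → ℝ) :
    Ex (s + (1 - s) * k) Λ f =
      Ex s Λ (fun ω => Ex k Λ (fun η => f (fun v => ω v || η v))) := by
  induction Λ using Finset.induction_on generalizing f with
  | empty =>
    simp [Ex_empty, cfg]
    rfl
  | insert v Λ hv ih =>
    have e : ∀ (ω η : Config) (b c : Bool),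
        (fun w => update ω v b w || update η v c w) =
          update (fun w => ω w || η w) v (b || c) := by
      intro ω η b c
      funext w
      by_cases h : w = v
      · subst h; simp
      · simp [h]
    rw [Ex_insert _ hv, Ex_insert _ hv, ih, ih]
    simp only [Ex_insert _ hv, e, Bool.true_or, Bool.false_or]
    simp only [Ex_add]
    have m : ∀ (c : ℝ) (g : Config → ℝ), Ex s Λ (fun ω => c * g ω) = c * Ex s Λ g := by
      intro c g
      simp only [Ex, Finset.mul_sum]
      exact Finset.sum_congr rfl fun B _ => by ring
    simp only [m]
    ring

/-! ### Probabilities -/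

/-- Probability of the event `A` under percolation of density `p` on `Λ`. -/
noncomputable def Pr (p : ℝ) (Λ : Finset Site) (A : Set Config) : ℝ :=
  Ex p Λ (A.indicator fun _ => 1)

lemma dependsOn_indicator {A : Set Config} {S : Set Site} (hA : DependsOn (· ∈ A) S) :
    DependsOn (A.indicator fun _ => (1 : ℝ)) S := by
  classical
  intro ω ω' h
  have := hA h
  simp only [Set.indicator_apply]
  simp only [eq_iff_iff] at this
  simp [this]

lemma monotone_indicator {A : Set Config} (hA : IsUpperSet A) :
    Monotone (A.indicator fun _ => (1 : ℝ)) := by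
  classical
  intro ω ω' h
  simp only [Set.indicator_apply]
  by_cases h1 : ω ∈ A
  · simp [h1, hA h h1]
  · simp only [h1, if_false]; split_ifs <;> norm_num

lemma indicator_inter_mul (A B : Set Config) :
    ((A ∩ B).indicator fun _ => (1 : ℝ)) =
      fun ω => A.indicator (fun _ => 1) ω * B.indicator (fun _ => 1) ω := by
  classical
  funext ω
  by_cases h1 : ω ∈ A <;> by_cases h2 : ω ∈ B <;> simp [h1, h2]

lemma Pr_univ (p : ℝ) (Λ : Finset Site) : Pr p Λ Set.univ = 1 := by
  simp [Pr, Set.indicator_univ, Ex_const]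

lemma Pr_compl (p : ℝ) (Λ : Finset Site) (A : Set Config) : Pr p Λ Aᶜ = 1 - Pr p Λ A := by
  classical
  have : (Aᶜ.indicator fun _ => (1 : ℝ)) = fun ω => 1 - A.indicator (fun _ => 1) ω := by
    funext ω
    by_cases h : ω ∈ A <;> simp [h]
  rw [Pr, this, Ex_sub, Ex_const, Pr]

lemma Pr_inter_of_disjoint (p : ℝ) (Λ : Finset Site) {A B : Set Config} {S T : Set Site}
    (hA : DependsOn (· ∈ A) S) (hB : DependsOn (· ∈ B) T) (hST : Disjoint S T) :
    Pr p Λ (A ∩ B) = Pr p Λ A * Pr p Λ B := by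
  rw [Pr, indicator_inter_mul,
    Ex_mul_of_disjoint p Λ (dependsOn_indicator hA) (dependsOn_indicator hB) hST]
  rfl

lemma Pr_congr_of_subset (p : ℝ) {Λ Λ' : Finset Site} (hΛ : Λ ⊆ Λ') {A : Set Config}
    (hA : DependsOn (· ∈ A) (Λ : Set Site)) : Pr p Λ' A = Pr p Λ A :=
  Ex_congr_of_subset p hΛ (dependsOn_indicator hA)

lemma Pr_map (p : ℝ) (e : Site ≃ Site) (Λ : Finset Site) (A : Set Config) :
    Pr p Λ {ω | ω ∘ e ∈ A} = Pr p (Λ.map e.symm.toEmbedding) A := by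
  rw [Pr, Pr, Ex_map]
  rfl

lemma Pr_flip (p : ℝ) (Λ : Finset Site) {A : Set Config}
    (hA : DependsOn (· ∈ A) (Λ : Set Site)) :
    Pr p Λ {ω | (fun v => !ω v) ∈ A} = Pr (1 - p) Λ A := by
  rw [Pr, Pr, ← Ex_flip p Λ (dependsOn_indicator hA)]
  rfl

section unitInterval

variable {p : ℝ} (hp0 : 0 ≤ p) (hp1 : p ≤ 1)
include hp0 hp1

lemma Pr_mono (Λ : Finset Site) {A B : Set Config} (h : A ⊆ B) : Pr p Λ A ≤ Pr p Λ B :=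
  Ex_mono hp0 hp1 Λ fun ω => Set.indicator_le_indicator_of_subset h (fun _ => zero_le_one) ω

lemma Pr_nonneg (Λ : Finset Site) (A : Set Config) : 0 ≤ Pr p Λ A :=
  Ex_nonneg hp0 hp1 Λ fun ω => Set.indicator_nonneg (fun _ _ => zero_le_one) ω

lemma Pr_le_one (Λ : Finset Site) (A : Set Config) : Pr p Λ A ≤ 1 := by
  rw [← Pr_univ p Λ]
  exact Pr_mono hp0 hp1 Λ (Set.subset_univ A)

lemma Pr_harris (Λ : Finset Site) {A B : Set Config} (hA : IsUpperSet A) (hB : IsUpperSet B) :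
    Pr p Λ A * Pr p Λ B ≤ Pr p Λ (A ∩ B) := by
  rw [Pr, Pr, Pr, indicator_inter_mul]
  exact Ex_harris hp0 hp1 Λ (monotone_indicator hA) (monotone_indicator hB)

lemma Pr_biUnion_le (Λ : Finset Site) {ι : Type*} (s : Finset ι) (A : Set Config)
    (B : ι → Set Config) (h : ∀ ω ∈ A, ∃ i ∈ s, ω ∈ B i) :
    Pr p Λ A ≤ ∑ i ∈ s, Pr p Λ (B i) := by
  classical
  simp only [Pr]
  rw [← Ex_sum]
  refine Ex_mono hp0 hp1 Λ fun ω => ?_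
  by_cases hω : ω ∈ A
  · obtain ⟨i, hi, hB⟩ := h ω hω
    rw [Set.indicator_of_mem hω]
    calc (1 : ℝ) = (B i).indicator (fun _ => 1) ω := by rw [Set.indicator_of_mem hB]
      _ ≤ _ := Finset.single_le_sum (f := fun i => (B i).indicator (fun _ => (1 : ℝ)) ω)
          (fun j _ => Set.indicator_nonneg (fun _ _ => zero_le_one) ω) hi
  · rw [Set.indicator_of_notMem hω]
    exact Finset.sum_nonneg fun j _ => Set.indicator_nonneg (fun _ _ => zero_le_one) ω

end unitInterval

end TriPerc

namespace TriPerc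

open Function Relation

/-! ### Connections in the triangular lattice -/

lemma triAdj_iff {u v : Site} : triAdj u v ↔
    (u.1 = v.1 + 1 ∧ u.2 = v.2) ∨ (u.1 = v.1 - 1 ∧ u.2 = v.2) ∨
    (u.1 = v.1 ∧ u.2 = v.2 + 1) ∨ (u.1 = v.1 ∧ u.2 = v.2 - 1) ∨
    (u.1 = v.1 + 1 ∧ u.2 = v.2 + 1) ∨ (u.1 = v.1 - 1 ∧ u.2 = v.2 - 1) := by
  simp only [triAdj, Set.mem_insert_iff, Set.mem_singleton_iff, Prod.ext_iff, Prod.fst_sub,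
    Prod.snd_sub]
  omega

lemma adj_symm {u v : Site} (h : triAdj u v) : triAdj v u := by
  rw [triAdj_iff] at *
  omega

/-- `u` and `v` are joined by a path inside `S`. -/
def Conn (S : Set Site) (u v : Site) : Prop :=
  u ∈ S ∧ ReflTransGen (fun a b => triAdj a b ∧ b ∈ S) u v

/-- The set of open sites. -/
def openSites (ω : Config) : Set Site := {v | ω v = true}

namespace Conn

variable {S S' : Set Site} {u v w : Site}

lemma refl (h : u ∈ S) : Conn S u u := ⟨h, .refl⟩

lemma left_mem (h : Conn S u v) : u ∈ S := h.1

lemma tail (h : Conn S u v) (hvw : triAdj v w) (hw : w ∈ S) : Conn S u w :=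
  ⟨h.1, h.2.tail ⟨hvw, hw⟩⟩

@[elab_as_elim]
lemma ind {P : Site → Prop} (h : Conn S u v) (h0 : P u)
    (step : ∀ a b, Conn S u a → triAdj a b → b ∈ S → P a → P b) : P v := by
  obtain ⟨hu, h⟩ := h
  induction h with
  | refl => exact h0
  | tail h1 h2 ih => exact step _ _ ⟨hu, h1⟩ h2.1 h2.2 ih

lemma right_mem (h : Conn S u v) : v ∈ S := h.ind h.1 fun _ _ _ _ hb _ => hb

lemma trans (h : Conn S u v) (h' : Conn S v w) : Conn S u w :=
  ⟨h.1, h.2.trans h'.2⟩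

lemma symm (h : Conn S u v) : Conn S v u := by
  refine h.ind (.refl h.1) fun a b ha hab hb ih => ?_
  exact ((refl hb).tail (adj_symm hab) ha.right_mem).trans ih

lemma of_adj (hu : u ∈ S) (h : triAdj u v) (hv : v ∈ S) : Conn S u v := (refl hu).tail h hv

lemma mono (h : Conn S u v) (hS : S ⊆ S') : Conn S' u v :=
  h.ind (.refl (hS h.1)) fun _ _ _ hab hb ih => ih.tail hab (hS hb)

lemma cluster (h : Conn S u v) : Conn {w | Conn S u w} u v :=
  h.ind (.refl (.refl h.1)) fun _ _ ha hab hb ih => ih.tail hab (ha.tail hab hb)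

lemma map (h : Conn S u v) {e : Site → Site} (he : ∀ a b, triAdj a b → triAdj (e a) (e b))
    (hS : ∀ w ∈ S, e w ∈ S') : Conn S' (e u) (e v) :=
  h.ind (.refl (hS _ h.1)) fun _ _ _ hab hb ih => ih.tail (he _ _ hab) (hS _ hb)

/-- The first exit of a path from a set. -/
lemma exit (h : Conn S u v) {K : Set Site} (hu : u ∈ K) (hv : v ∉ K) :
    ∃ x y, Conn (S ∩ K) u x ∧ triAdj x y ∧ y ∈ S ∧ y ∉ K := by
  by_contra hc
  push Not at hc
  have : Conn (S ∩ K) u v := h.ind (.refl ⟨h.1, hu⟩) fun a b _ hab hb ih =>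
    ih.tail hab ⟨hb, hc a b ih hab hb⟩
  exact hv this.right_mem.2

/-- The last exit of a path from a set. -/
lemma last_exit (h : Conn S u v) {K : Set Site} (hu : u ∈ K) (hv : v ∉ K) :
    ∃ x y, x ∈ S ∧ x ∈ K ∧ triAdj x y ∧ Conn (S \ K) y v := by
  obtain ⟨y, x, h1, h2, h3, h4⟩ := h.symm.exit (K := Kᶜ) hv (by simpa using hu)
  exact ⟨x, y, h3, by simpa using h4, adj_symm h2, h1.symm⟩

/-- The first hitting of a level by a path. -/
lemma hit (h : Conn S u v) {f : Site → ℤ} (hf : ∀ a b, triAdj a b → f b ≤ f a + 1) {m : ℤ}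
    (hu : f u ≤ m) (hv : m ≤ f v) : ∃ y, f y = m ∧ Conn (S ∩ {w | f w ≤ m}) u y := by
  rcases hu.eq_or_lt with hu | hu
  · exact ⟨u, hu, .refl ⟨h.1, hu.le⟩⟩
  · obtain ⟨x, y, h1, h2, h3, h4⟩ := h.exit (K := {w | f w < m}) hu (by simpa using hv)
    have hx : f x < m := h1.right_mem.2
    have := hf x y h2
    have hy : f y = m := by simp only [Set.mem_ofPred_eq] at h4; omega
    exact ⟨y, hy, (h1.mono fun w hw => And.intro hw.1 (le_of_lt hw.2)).tail h2 ⟨h3, hy.le⟩⟩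

/-- A vertical segment of sites is connected. -/
lemma vert {x y y' : ℤ} (h : y ≤ y') (hS : ∀ z, y ≤ z → z ≤ y' → (x, z) ∈ S) :
    Conn S (x, y) (x, y') := by
  obtain ⟨k, rfl⟩ := Int.le.dest h
  induction k with
  | zero => simpa using Conn.refl (hS y le_rfl (by simp))
  | succ k ih =>
    refine (ih (by simp) fun z h1 h2 => hS z h1 (by push_cast; omega)).tail ?_
      (hS _ (by push_cast; omega) le_rfl)
    rw [triAdj_iff]; push_cast; simp; omega

lemma exists_list (h : Conn S u v) : ∃ l : List Site, l ≠ [] ∧ List.IsChain triAdj l ∧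
    (∀ w ∈ l, w ∈ S) ∧ l.head? = some u ∧ l.getLast? = some v := by
  refine h.ind ⟨[u], by simp, List.isChain_singleton _, by simpa using h.1, rfl, rfl⟩ ?_
  rintro a b ha hab hb ⟨l, h0, h1, h2, h3, h4⟩
  refine ⟨l ++ [b], by simp, ?_, ?_, ?_, by simp⟩
  · refine List.isChain_append.2 ⟨h1, by simp, ?_⟩
    intro x hx y hy
    rw [h4] at hx
    simp at hx hy
    subst hx hy; exact hab
  · intro w hw
    rcases List.mem_append.1 hw with hw | hw
    · exact h2 w hw
    · simp at hw; subst hw; exact hb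
  · rw [List.head?_append, h3]; rfl

end Conn

lemma inter_openSites_congr {S : Set Site} {ω ω' : Config} (h : ∀ v ∈ S, ω v = ω' v) :
    S ∩ openSites ω = S ∩ openSites ω' := by
  ext v
  constructor <;> rintro ⟨h1, h2⟩ <;> refine ⟨h1, ?_⟩ <;> have := h v h1 <;>
    simp_all [openSites]

lemma openSites_mono {ω ω' : Config} (h : ω ≤ ω') : openSites ω ⊆ openSites ω' := by
  intro v hv
  have h1 := h v
  simp only [openSites, Set.mem_ofPred_eq] at *
  rw [hv] at h1
  exact Bool.eq_true_of_true_le h1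

/-- Events defined through the open sites of `S`, as increasing events. -/
lemma isUpperSet_of_openSites {S : Set Site} {P : Set Site → Prop}
    (hP : ∀ T T', T ⊆ T' → P T → P T') : IsUpperSet {ω : Config | P (S ∩ openSites ω)} :=
  fun _ _ h h1 => hP _ _ (Set.inter_subset_inter_right _ (openSites_mono h)) h1

lemma dependsOn_of_openSites (S : Set Site) (P : Set Site → Prop) :
    DependsOn (· ∈ {ω : Config | P (S ∩ openSites ω)}) S := by
  intro ω ω' h
  simp only [Set.mem_ofPred_eq, inter_openSites_congr h]

lemma DependsOn.mono' {β : Type*} {f : Config → β} {S T : Set Site} (hf : DependsOn f S)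
    (h : S ⊆ T) : DependsOn f T := fun _ _ hT => hf fun v hv => hT v (h hv)

lemma parity_step {x y e v1 v2 w1 w2 : ℤ} (he : e = 0 ∨ e = 1)
    (hvw : v1 = w1 + 1 ∧ v2 = w2 ∨ v1 = w1 - 1 ∧ v2 = w2 ∨ v1 = w1 ∧ v2 = w2 + 1 ∨
      v1 = w1 ∧ v2 = w2 - 1 ∨ v1 = w1 + 1 ∧ v2 = w2 + 1 ∨ v1 = w1 - 1 ∧ v2 = w2 - 1)
    (hx : ¬(v1 = x ∧ v2 = y) ∧ ¬(w1 = x ∧ w2 = y))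
    (hy : ¬(v1 = x + 1 ∧ v2 = y + e) ∧ ¬(w1 = x + 1 ∧ w2 = y + e)) :
    ((if v1 = x ∧ w1 = x + 1 ∧ y < v2 ∨ w1 = x ∧ v1 = x + 1 ∧ y < w2 then (1 : ℤ) else 0)
      - (if v1 = x + 1 ∧ w1 = x + 1 + 1 ∧ y + e < v2 ∨
          w1 = x + 1 ∧ v1 = x + 1 + 1 ∧ y + e < w2 then 1 else 0)
      + (if v1 = x + 1 ∧ y < v2 then 1 else 0) - (if w1 = x + 1 ∧ y < w2 then 1 else 0)) % 2
      = 0 := by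
  rcases he with rfl | rfl <;> rcases hvw with h | h | h | h | h | h <;>
    obtain ⟨rfl, rfl⟩ := h <;> grind

/-- A path crossing a rectangle from left to right meets every path crossing it from top to
bottom. -/
theorem crossing {G D : Set Site} {u v s t : Site} {a b c d : ℤ} (hG : Conn G u v)
    (hD : Conn D s t) (hu : u.1 < a) (hv : b < v.1) (hG' : ∀ w ∈ G, c < w.2 ∧ w.2 < d)
    (hD' : ∀ w ∈ D, a ≤ w.1 ∧ w.1 ≤ b) (hs : d ≤ s.2) (ht : t.2 ≤ c) :
    ∃ w ∈ G, w ∈ D := by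
  by_contra hc
  push Not at hc
  obtain ⟨N, h1, h2, h3, h4⟩ : ∃ N : ℤ → ℤ → ℤ,
      (∀ x y, (x, y) ∉ G → (x, y + 1) ∉ G → (N x y - N x (y + 1)) % 2 = 0) ∧
      (∀ x y e, (e = 0 ∨ e = 1) → (x, y) ∉ G → (x + 1, y + e) ∉ G →
        (N x y - N (x + 1) (y + e) - (if u.1 = x + 1 ∧ y < u.2 then 1 else 0)
          - (if v.1 = x + 1 ∧ y < v.2 then 1 else 0)) % 2 = 0) ∧
      (∀ x y, d ≤ y → N x y % 2 = 0) ∧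
      (∀ x y, y ≤ c → (N x y - (if u.1 ≤ x then 1 else 0)
          - (if v.1 ≤ x then 1 else 0)) % 2 = 0) := by
    refine hG.ind ⟨fun _ _ => 0, ?_, ?_, ?_, ?_⟩ ?_
    · intros; rfl
    · intros; split_ifs <;> rfl
    · intros; rfl
    · intros; split_ifs <;> rfl
    · rintro ⟨v1, v2⟩ ⟨w1, w2⟩ hv hvw hw ⟨N, h1, h2, h3, h4⟩
      have hv := hv.right_mem
      have hvc := hG' _ hv
      have hwc := hG' _ hw
      rw [triAdj_iff] at hvw
      simp only at hvw hvc hwc h1 h2 h3 h4 ⊢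
      have key : ∀ x y, (x, y) ∉ G → ¬ (v1 = x ∧ v2 = y) ∧ ¬ (w1 = x ∧ w2 = y) := by
        intro x y h
        constructor
        · rintro ⟨rfl, rfl⟩; exact h hv
        · rintro ⟨rfl, rfl⟩; exact h hw
      refine ⟨fun x y => N x y + if (v1 = x ∧ w1 = x + 1 ∧ y < v2) ∨
        (w1 = x ∧ v1 = x + 1 ∧ y < w2) then 1 else 0, ?_, ?_, ?_, ?_⟩
      · intro x y hx hy
        have := h1 x y hx hy
        have := key _ _ hx
        have := key _ _ hy
        simp only
        split_ifs <;> omega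
      · intro x y e he hx hy
        have h2' := h2 x y e he hx hy
        simp only
        have aux : ∀ A B i j i' k l : ℤ, (A - B - i - j) % 2 = 0 → (k - l + j - i') % 2 = 0 →
          (A + k - (B + l) - i - i') % 2 = 0 := by intros; omega
        refine aux _ _ _ _ _ _ _ h2' ?_
        exact parity_step he hvw (key _ _ hx) (key _ _ hy)
      · intro x y hy
        have := h3 x y hy
        simp only
        split_ifs <;> omega
      · intro x y hy
        have := h4 x y hy
        clear h1 h2 h3 h4 hc key hG' hD'
        simp only
        have aux : ∀ A i j i' k : ℤ, (A - i - j) % 2 = 0 → (k + j - i') % 2 = 0 →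
          (A + k - i - i') % 2 = 0 := by intros; omega
        refine aux _ _ _ _ _ this ?_
        split_ifs <;> omega
  have hN : (N s.1 s.2 - N t.1 t.2) % 2 = 0 := by
    refine hD.ind (by simp) ?_
    rintro ⟨p1, p2⟩ ⟨q1, q2⟩ hp hpq hq ih
    have hp := hp.right_mem
    have hp' := hD' _ hp
    have hq' := hD' _ hq
    have np : (p1, p2) ∉ G := fun h => hc _ h hp
    have nq : (q1, q2) ∉ G := fun h => hc _ h hq
    rw [triAdj_iff] at hpq
    simp only at *
    have z : ∀ x y e, a ≤ x → x + 1 ≤ b → (e = 0 ∨ e = 1) → (x, y) ∉ G → (x + 1, y + e) ∉ G →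
        (N x y - N (x + 1) (y + e)) % 2 = 0 := by
      intro x y e hx hx' he n1 n2
      have := h2 x y e he n1 n2
      rw [if_neg (by omega), if_neg (by omega)] at this
      simpa using this
    have e0 : ∀ z : ℤ, z + 0 = z := fun z => by simp
    rcases hpq with ⟨rfl, rfl⟩ | ⟨rfl, rfl⟩ | ⟨rfl, rfl⟩ | ⟨rfl, rfl⟩ | ⟨rfl, rfl⟩ | ⟨rfl, rfl⟩
    · have := z q1 p2 0 (by omega) (by omega) (by simp) nq (by simpa using np)
      simp only [e0] at this; omega
    · have := z (q1 - 1) p2 0 (by omega) (by omega) (by simp) np (by simpa using nq)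
      simp only [e0, sub_add_cancel] at this; omega
    · have := h1 _ _ nq np
      omega
    · have := h1 p1 (q2 - 1) np (by simpa using nq)
      simp only [sub_add_cancel] at this; omega
    · have := z q1 q2 1 (by omega) (by omega) (by simp) nq np
      omega
    · have := z (q1 - 1) (q2 - 1) 1 (by omega) (by omega) (by simp) np (by simpa using nq)
      simp only [sub_add_cancel] at this; omega
  have e1 := h3 s.1 s.2 hs
  have e2 := h4 t.1 t.2 ht
  have ht' := hD' _ hD.right_mem
  rw [if_pos (by omega), if_neg (by omega)] at e2
  omega

end TriPerc

namespace TriPerc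

open Function Relation

/-! ### The Hex lemma -/

lemma triangle_parity {a b c la lb lc ka kb kc : Prop} [Decidable la] [Decidable lb]
    [Decidable lc] [Decidable ka] [Decidable kb] [Decidable kc]
    (hla : la → a) (hlb : lb → b) (hlc : lc → c) (hka : ka → ¬a) (hkb : kb → ¬b) (hkc : kc → ¬c)
    (lab : a → b → (la ↔ lb)) (lbc : b → c → (lb ↔ lc)) (lac : a → c → (la ↔ lc))
    (kab : ¬a → ¬b → (ka ↔ kb)) (kbc : ¬b → ¬c → (kb ↔ kc)) (kac : ¬a → ¬c → (ka ↔ kc)) :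
    (if (la ∧ kb) ∨ (ka ∧ lb) then (1 : ZMod 2) else 0) +
      (if (lb ∧ kc) ∨ (kb ∧ lc) then 1 else 0) + (if (la ∧ kc) ∨ (ka ∧ lc) then 1 else 0) = 0 := by
  have h2 : (1 : ZMod 2) + 1 = 0 := by decide
  by_cases a <;> by_cases b <;> by_cases c <;> by_cases la <;> by_cases lb <;> by_cases lc <;>
    by_cases ka <;> by_cases kb <;> by_cases kc <;> simp_all

lemma edge_parity {a b la lb ka kb : Prop} [Decidable la] [Decidable lb] [Decidable ka]
    [Decidable kb] (hla : a ↔ la) (hlb : b ↔ lb) (hka : ka → ¬a) (hkb : kb → ¬b)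
    (kab : ¬a → ¬b → (ka ↔ kb)) :
    (if (la ∧ kb) ∨ (ka ∧ lb) then (1 : ZMod 2) else 0) =
      (if ka then 1 else 0) + (if kb then 1 else 0) := by
  have h2 : (1 : ZMod 2) + 1 = 0 := by decide
  by_cases a <;> by_cases b <;> by_cases ka <;> by_cases kb <;> simp_all

lemma sum_range_add_succ (f : ℕ → ZMod 2) (n : ℕ) :
    ∑ i ∈ Finset.range n, (f i + f (i + 1)) = f 0 + f n := by
  have h : ∀ x : ZMod 2, x + x = 0 := by decide
  induction n with
  | zero => simp [h]
  | succ n ih =>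
    rw [Finset.sum_range_succ, ih]
    linear_combination h (f n)

/-- The Hex lemma: a set of sites crosses the box from left to right, or its complement crosses
the box from top to bottom. -/
theorem hex (n : ℕ) (A : Set Site) :
    (∃ u v : Site, u.1 = 0 ∧ v.1 = n ∧ Conn (box n ∩ A) u v) ∨
      ∃ u v : Site, u.2 = 0 ∧ v.2 = n ∧ Conn (box n \ A) u v := by
  classical
  by_contra hc
  push Not at hc
  obtain ⟨hc1, hc2⟩ := hc
  let L : ℕ → ℕ → Prop := fun i j => ∃ u : Site, u.1 = 0 ∧ Conn (box n ∩ A) u (i, j)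
  let K : ℕ → ℕ → Prop := fun i j => ∃ u : Site, u.2 = 0 ∧ Conn (box n \ A) u (i, j)
  let a : ℕ → ℕ → Prop := fun i j => ((i, j) : Site) ∈ A
  have hLa : ∀ i j, L i j → a i j := fun i j ⟨u, _, h⟩ => h.right_mem.2
  have hKa : ∀ i j, K i j → ¬ a i j := fun i j ⟨u, _, h⟩ => h.right_mem.2
  have hbox : ∀ i j : ℕ, i ≤ n → j ≤ n → ((i, j) : Site) ∈ box n := by
    intro i j hi hj
    simp only [box, Set.mem_ofPred_eq]
    omega
  have Ladj : ∀ i j i' j' : ℕ, i ≤ n → j ≤ n → i' ≤ n → j' ≤ n →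
      triAdj ((i : ℤ), (j : ℤ)) (i', j') → a i j → a i' j' → (L i j ↔ L i' j') := by
    intro i j i' j' h1 h2 h3 h4 hadj ha ha'
    exact ⟨fun ⟨u, hu, h⟩ => ⟨u, hu, h.tail hadj ⟨hbox _ _ h3 h4, ha'⟩⟩,
      fun ⟨u, hu, h⟩ => ⟨u, hu, h.tail (adj_symm hadj) ⟨hbox _ _ h1 h2, ha⟩⟩⟩
  have Kadj : ∀ i j i' j' : ℕ, i ≤ n → j ≤ n → i' ≤ n → j' ≤ n →
      triAdj ((i : ℤ), (j : ℤ)) (i', j') → ¬ a i j → ¬ a i' j' → (K i j ↔ K i' j') := by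
    intro i j i' j' h1 h2 h3 h4 hadj ha ha'
    exact ⟨fun ⟨u, hu, h⟩ => ⟨u, hu, h.tail hadj ⟨hbox _ _ h3 h4, ha'⟩⟩,
      fun ⟨u, hu, h⟩ => ⟨u, hu, h.tail (adj_symm hadj) ⟨hbox _ _ h1 h2, ha⟩⟩⟩
  have L0 : ∀ j ≤ n, a 0 j → L 0 j := fun j hj h => ⟨_, by simp, .refl ⟨hbox _ _ (by simp) hj, h⟩⟩
  have K0 : ∀ i ≤ n, ¬ a i 0 → K i 0 := fun i hi h => ⟨_, by simp, .refl ⟨hbox _ _ hi (by simp), h⟩⟩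
  have Ln : ∀ j, ¬ L n j := fun j ⟨u, hu, h⟩ => hc1 u _ hu rfl h
  have Kn : ∀ i, ¬ K i n := fun i ⟨u, hu, h⟩ => hc2 u _ hu rfl h
  let H : ℕ → ℕ → ZMod 2 := fun i j =>
    if (L i j ∧ K (i + 1) j) ∨ (K i j ∧ L (i + 1) j) then 1 else 0
  let V : ℕ → ℕ → ZMod 2 := fun i j =>
    if (L i j ∧ K i (j + 1)) ∨ (K i j ∧ L i (j + 1)) then 1 else 0
  let D : ℕ → ℕ → ZMod 2 := fun i j =>
    if (L i j ∧ K (i + 1) (j + 1)) ∨ (K i j ∧ L (i + 1) (j + 1)) then 1 else 0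
  let l : ℕ → ZMod 2 := fun i => if L i 0 then 1 else 0
  let k : ℕ → ZMod 2 := fun j => if K 0 j then 1 else 0
  have hx : ∀ x : ZMod 2, x + x = 0 := by decide
  have square : ∀ i < n, ∀ j < n, (H i j + H i (j + 1)) + (V i j + V (i + 1) j) = 0 := by
    intro i hi j hj
    have t1 := triangle_parity (hLa i j) (hLa (i + 1) j) (hLa (i + 1) (j + 1))
      (hKa i j) (hKa (i + 1) j) (hKa (i + 1) (j + 1))
      (Ladj i j (i + 1) j (by omega) (by omega) (by omega) (by omega) (by simp [triAdj_iff]))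
      (Ladj (i + 1) j (i + 1) (j + 1) (by omega) (by omega) (by omega) (by omega)
        (by simp [triAdj_iff]))
      (Ladj i j (i + 1) (j + 1) (by omega) (by omega) (by omega) (by omega) (by simp [triAdj_iff]))
      (Kadj i j (i + 1) j (by omega) (by omega) (by omega) (by omega) (by simp [triAdj_iff]))
      (Kadj (i + 1) j (i + 1) (j + 1) (by omega) (by omega) (by omega) (by omega)
        (by simp [triAdj_iff]))
      (Kadj i j (i + 1) (j + 1) (by omega) (by omega) (by omega) (by omega) (by simp [triAdj_iff]))
    have t2 := triangle_parity (hLa i j) (hLa i (j + 1)) (hLa (i + 1) (j + 1))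
      (hKa i j) (hKa i (j + 1)) (hKa (i + 1) (j + 1))
      (Ladj i j i (j + 1) (by omega) (by omega) (by omega) (by omega) (by simp [triAdj_iff]))
      (Ladj i (j + 1) (i + 1) (j + 1) (by omega) (by omega) (by omega) (by omega)
        (by simp [triAdj_iff]))
      (Ladj i j (i + 1) (j + 1) (by omega) (by omega) (by omega) (by omega) (by simp [triAdj_iff]))
      (Kadj i j i (j + 1) (by omega) (by omega) (by omega) (by omega) (by simp [triAdj_iff]))
      (Kadj i (j + 1) (i + 1) (j + 1) (by omega) (by omega) (by omega) (by omega)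
        (by simp [triAdj_iff]))
      (Kadj i j (i + 1) (j + 1) (by omega) (by omega) (by omega) (by omega) (by simp [triAdj_iff]))
    change H i j + V (i + 1) j + D i j = 0 at t1
    change V i j + H i (j + 1) + D i j = 0 at t2
    linear_combination t1 + t2 - hx (D i j)
  have hV0 : ∀ j < n, V 0 j = k j + k (j + 1) := fun j hj =>
    edge_parity ⟨L0 j hj.le, hLa 0 j⟩ ⟨L0 (j + 1) hj, hLa 0 (j + 1)⟩ (hKa 0 j) (hKa 0 (j + 1))
      (Kadj 0 j 0 (j + 1) (by omega) (by omega) (by omega) (by omega) (by simp [triAdj_iff]))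
  have hH0 : ∀ i < n, H i 0 = l i + l (i + 1) := by
    intro i hi
    have := edge_parity (a := ¬ a i 0) (b := ¬ a (i + 1) 0) ⟨K0 i hi.le, hKa i 0⟩
      ⟨K0 (i + 1) hi, hKa (i + 1) 0⟩ (not_not.2 ∘ hLa i 0) (not_not.2 ∘ hLa (i + 1) 0)
      (fun h h' => Ladj i 0 (i + 1) 0 (by omega) (by omega) (by omega) (by omega)
        (by simp [triAdj_iff]) (not_not.1 h) (not_not.1 h'))
    rw [← this]
    simp only [H, or_comm]
  have hVn : ∀ j, V n j = 0 := by intro j; simp [V, Ln]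
  have hHn : ∀ i, H i n = 0 := by intro j; simp [H, Kn]
  have S0 : ∑ i ∈ Finset.range n, ∑ j ∈ Finset.range n,
      ((H i j + H i (j + 1)) + (V i j + V (i + 1) j)) = 0 :=
    Finset.sum_eq_zero fun i hi => Finset.sum_eq_zero fun j hj =>
      square i (Finset.mem_range.1 hi) j (Finset.mem_range.1 hj)
  have S1 : ∑ i ∈ Finset.range n, ∑ j ∈ Finset.range n, (H i j + H i (j + 1)) = l 0 + l n := by
    rw [← sum_range_add_succ]
    refine Finset.sum_congr rfl fun i hi => ?_
    rw [sum_range_add_succ (H i), hHn, hH0 i (Finset.mem_range.1 hi), add_zero]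
  have S2 : ∑ i ∈ Finset.range n, ∑ j ∈ Finset.range n, (V i j + V (i + 1) j) = k 0 + k n := by
    rw [Finset.sum_comm, ← sum_range_add_succ]
    refine Finset.sum_congr rfl fun j hj => ?_
    rw [sum_range_add_succ (fun i => V i j), hVn, hV0 j (Finset.mem_range.1 hj), add_zero]
  simp only [Finset.sum_add_distrib] at S0 S1 S2
  rw [S1, S2] at S0
  have e1 : l n = 0 := if_neg (Ln 0)
  have e2 : k n = 0 := if_neg (Kn 0)
  have e3 : l 0 + k 0 = 1 := by
    simp only [l, k]
    by_cases h : a 0 0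
    · rw [if_pos (L0 0 (by simp) h), if_neg (fun h' => hKa _ _ h' h), add_zero]
    · rw [if_neg (fun h' => h (hLa _ _ h')), if_pos (K0 0 (by simp) h), zero_add]
  rw [e1, e2, add_zero, add_zero, e3] at S0
  exact one_ne_zero S0

/-! ### Disjoint crossings -/

/-- `Reach n O k v`: some walk in the box from the bottom side to `v` visits `O` exactly `k`
times. -/
inductive Reach (n : ℕ) (O : Set Site) : ℕ → Site → Prop
  | start_mem {v} : v ∈ box n → v.2 = 0 → v ∈ O → Reach n O 1 v
  | start_notMem {v} : v ∈ box n → v.2 = 0 → v ∉ O → Reach n O 0 v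
  | step_mem {k u v} : Reach n O k u → triAdj u v → v ∈ box n → v ∈ O → Reach n O (k + 1) v
  | step_notMem {k u v} : Reach n O k u → triAdj u v → v ∈ box n → v ∉ O → Reach n O k v

lemma Reach.exists_conn {n : ℕ} {O : Set Site} {k : ℕ} {v : Site} (h : Reach n O k v) :
    ∃ T : Finset Site, T.card ≤ k ∧ ∃ u : Site, u.2 = 0 ∧ Conn (box n ∩ (Oᶜ ∪ T)) u v := by
  classical
  induction h with
  | @start_mem v h1 h2 h3 => exact ⟨{v}, by simp, v, h2, .refl ⟨h1, by simp⟩⟩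
  | @start_notMem v h1 h2 h3 => exact ⟨∅, by simp, v, h2, .refl ⟨h1, by simpa using h3⟩⟩
  | @step_mem k u v _ h2 h3 h4 ih =>
    obtain ⟨T, hT, w, hw, h⟩ := ih
    refine ⟨insert v T, (Finset.card_insert_le _ _).trans (by omega), w, hw,
      (h.mono ?_).tail h2 ⟨h3, by simp⟩⟩
    rintro x ⟨hx, hx' | hx'⟩
    · exact ⟨hx, Or.inl hx'⟩
    · exact ⟨hx, Or.inr (by simp at hx'; simp [hx'])⟩
  | @step_notMem k u v _ h2 h3 h4 ih =>
    obtain ⟨T, hT, w, hw, h⟩ := ih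
    exact ⟨T, hT, w, hw, h.tail h2 ⟨h3, Or.inl h4⟩⟩

/-- Either there are `r + 1` disjoint open crossings, or opening up the closed sites by at most
`r` more sites creates a crossing in the other direction. -/
theorem disjointCrossings_or (n r : ℕ) (ω : Config) : HasDisjointCrossings n ω (r + 1) ∨
    ∃ T : Finset Site, T.card ≤ r ∧ ∃ u v : Site, u.2 = 0 ∧ v.2 = n ∧
      Conn (box n ∩ ((openSites ω)ᶜ ∪ T)) u v := by
  by_cases hr : ∃ v : Site, v.2 = n ∧ ∃ k ≤ r, Reach n (openSites ω) k v
  · right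
    obtain ⟨v, hv, k, hk, h⟩ := hr
    obtain ⟨T, hT, u, hu, h⟩ := h.exists_conn
    exact ⟨T, hT.trans hk, u, v, hu, hv, h⟩
  left
  set O := openSites ω with hO
  let Le : ℕ → Site → Prop := fun k v => ∃ k' ≤ k, Reach n O k' v
  let X : ℕ → Set Site := fun k => {v | v ∈ O ∧ Le (k + 1) v ∧ ¬ Le k v}
  have cross : ∀ k ≤ r, ∃ u v : Site, u.1 = 0 ∧ v.1 = n ∧ Conn (box n ∩ X k) u v := by
    intro k hk
    rcases hex n (X k) with h | ⟨u, v, hu, hv, h⟩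
    · exact h
    exfalso
    apply hr
    have : Le k v := by
      refine h.ind ?_ ?_
      · have hub := h.left_mem
        by_cases huO : u ∈ O
        · by_contra hne
          exact hub.2 ⟨huO, ⟨1, by simp, .start_mem hub.1 hu huO⟩, hne⟩
        · exact ⟨0, by simp, .start_notMem hub.1 hu huO⟩
      · rintro a b - hab hb ⟨k', hk', ih⟩
        by_cases hbO : b ∈ O
        · by_contra hne
          exact hb.2 ⟨hbO, ⟨k' + 1, by simpa using hk', ih.step_mem hab hb.1 hbO⟩, hne⟩
        · exact ⟨k', hk', ih.step_notMem hab hb.1 hbO⟩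
    obtain ⟨k', hk', h'⟩ := this
    exact ⟨v, hv, k', hk'.trans hk, h'⟩
  choose! u v hu hv hc using cross
  have hl : ∀ k ≤ r, ∃ l : List Site, IsLRCrossing n true ω l ∧ ∀ w ∈ l, w ∈ X k := by
    intro k hk
    obtain ⟨l, -, h1, h2, h3, h4⟩ := (hc k hk).exists_list
    exact ⟨l, ⟨h1, fun w hw => ⟨(h2 w hw).1, (h2 w hw).2.1⟩, ⟨_, h3, hu k hk⟩, ⟨_, h4, hv k hk⟩⟩,
      fun w hw => (h2 w hw).2⟩
  choose! l hl1 hl2 using hl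
  have hlt : ∀ i j, i < j → ∀ w, w ∈ X i → w ∉ X j := by
    rintro i j hij w ⟨-, ⟨k, hk, h⟩, -⟩ ⟨-, -, h'⟩
    exact h' ⟨k, by omega, h⟩
  refine ⟨fun i => l i, fun i => hl1 i (by omega), fun i j hij w hi hj => ?_⟩
  have hi := hl2 i (by omega) w hi
  have hj := hl2 j (by omega) w hj
  rcases lt_or_gt_of_ne (fun h => hij (Fin.ext h) : (i : ℕ) ≠ j) with h | h
  · exact hlt _ _ h w hi hj
  · exact hlt _ _ h w hj hi

end TriPerc

namespace TriPerc

open Function Relation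

open scoped Classical in
lemma Pr_partition (p : ℝ) (Λ : Finset Site) (E : Set Config) (s : Finset (Finset Site))
    (g : Config → Finset Site) (hg : ∀ ω, g ω ∈ s) :
    Pr p Λ E = ∑ K ∈ s, Pr p Λ (E ∩ {ω | g ω = K}) := by
  simp only [Pr]
  rw [← Ex_sum]
  congr 1
  funext ω
  simp only [indicator_inter_mul, ← Finset.mul_sum]
  have : ∑ K ∈ s, ({ω | g ω = K} : Set Config).indicator (fun _ => (1 : ℝ)) ω = 1 := by
    simp [Set.indicator_apply, hg]
  rw [this, mul_one]

lemma Ex_mono_param {s q : ℝ} (hs : 0 ≤ s) (hsq : s ≤ q) (hq : q ≤ 1) (Λ : Finset Site)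
    {f : Config → ℝ} (hf : Monotone f) : Ex s Λ f ≤ Ex q Λ f := by
  rcases hsq.eq_or_lt with rfl | hsq
  · exact le_rfl
  have h1 : 0 < 1 - s := by linarith
  have hk0 : 0 ≤ (q - s) / (1 - s) := div_nonneg (by linarith) h1.le
  have hk1 : (q - s) / (1 - s) ≤ 1 := (div_le_one h1).2 (by linarith)
  have e : q = s + (1 - s) * ((q - s) / (1 - s)) := by field_simp; ring
  rw [e, Ex_sprinkle]
  refine Ex_mono hs (by linarith) Λ fun ω => ?_
  calc f ω = Ex ((q - s) / (1 - s)) Λ (fun _ => f ω) := (Ex_const _ _ _).symm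
    _ ≤ _ := Ex_mono hk0 hk1 Λ fun η => hf fun v => by
      cases ω v <;> simp

lemma Pr_mono_param {s q : ℝ} (hs : 0 ≤ s) (hsq : s ≤ q) (hq : q ≤ 1) (Λ : Finset Site)
    {A : Set Config} (hA : IsUpperSet A) : Pr s Λ A ≤ Pr q Λ A :=
  Ex_mono_param hs hsq hq Λ (monotone_indicator hA)

/-! ### Clusters -/

open scoped Classical in
/-- The sites joined to `A` by open paths in `D`. -/
noncomputable def clus (A : Set Site) (D : Finset Site) (ω : Config) : Finset Site :=
  D.filter fun x => ∃ a ∈ A, Conn (D ∩ openSites ω) a x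

open scoped Classical in
/-- The sites which have to be closed when `K` is the cluster of `A` in `D`. -/
noncomputable def fringe (A : Set Site) (D K : Finset Site) : Finset Site :=
  D.filter fun v => v ∉ K ∧ (v ∈ A ∨ ∃ x ∈ K, triAdj x v)

lemma mem_clus {A : Set Site} {D : Finset Site} {ω : Config} {x : Site} :
    x ∈ clus A D ω ↔ ∃ a ∈ A, Conn (D ∩ openSites ω) a x := by
  classical
  simp only [clus, Finset.mem_filter, and_iff_right_iff_imp]
  rintro ⟨a, -, h⟩
  exact h.right_mem.1

lemma mem_fringe {A : Set Site} {D K : Finset Site} {v : Site} :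
    v ∈ fringe A D K ↔ v ∈ D ∧ v ∉ K ∧ (v ∈ A ∨ ∃ x ∈ K, triAdj x v) := by
  simp [fringe]

lemma clus_subset (A : Set Site) (D : Finset Site) (ω : Config) : clus A D ω ⊆ D := by
  intro x hx
  obtain ⟨a, -, h⟩ := mem_clus.1 hx
  exact h.right_mem.1

lemma clus_eq_iff {A : Set Site} {D K : Finset Site} (hK : K ⊆ D) (ω : Config) :
    clus A D ω = K ↔ (∀ v ∈ K, ω v = true) ∧ (∀ v ∈ fringe A D K, ω v = false) ∧
      ∀ x ∈ K, ∃ a ∈ A, Conn K a x := by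
  constructor
  · rintro rfl
    refine ⟨fun v hv => ?_, fun v hv => ?_, fun x hx => ?_⟩
    · obtain ⟨a, -, h⟩ := mem_clus.1 hv
      exact h.right_mem.2
    · rw [mem_fringe] at hv
      obtain ⟨h1, h2, h3⟩ := hv
      by_contra hv
      rw [Bool.not_eq_false] at hv
      apply h2
      rw [mem_clus]
      rcases h3 with h3 | ⟨x, hx, h3⟩
      · exact ⟨v, h3, .refl ⟨h1, hv⟩⟩
      · obtain ⟨a, ha, h⟩ := mem_clus.1 hx
        exact ⟨a, ha, h.tail h3 ⟨h1, hv⟩⟩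
    · obtain ⟨a, ha, h⟩ := mem_clus.1 hx
      exact ⟨a, ha, h.cluster.mono fun w hw => mem_clus.2 ⟨a, ha, hw⟩⟩
  · rintro ⟨h1, h2, h3⟩
    ext x
    rw [mem_clus]
    constructor
    · rintro ⟨a, ha, h⟩
      refine h.ind ?_ ?_
      · by_contra hn
        have := h2 a (mem_fringe.2 ⟨h.left_mem.1, hn, Or.inl ha⟩)
        have h' : ω a = true := h.left_mem.2
        simp [this] at h'
      · intro b c _ hbc hc hb
        by_contra hn
        have := h2 c (mem_fringe.2 ⟨hc.1, hn, Or.inr ⟨b, hb, hbc⟩⟩)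
        have h' : ω c = true := hc.2
        simp [this] at h'
    · intro hx
      obtain ⟨a, ha, h⟩ := h3 x hx
      exact ⟨a, ha, h.mono fun w hw => ⟨hK hw, h1 w hw⟩⟩

lemma dependsOn_clus_eq {A : Set Site} {D K : Finset Site} (hK : K ⊆ D) :
    DependsOn (· ∈ {ω | clus A D ω = K}) ((K : Set Site) ∪ fringe A D K) := by
  intro ω ω' h
  have h1 : (∀ v ∈ K, ω v = true) ↔ ∀ v ∈ K, ω' v = true :=
    forall₂_congr fun v hv => by rw [h v (Or.inl hv)]
  have h2 : (∀ v ∈ fringe A D K, ω v = false) ↔ ∀ v ∈ fringe A D K, ω' v = false :=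
    forall₂_congr fun v hv => by rw [h v (Or.inr hv)]
  simp only [Set.mem_ofPred_eq, clus_eq_iff hK, h1, h2]

/-! ### Balls and arms -/

/-- The graph distance to the origin. -/
def hnorm (v : Site) : ℤ :=
  max (max (max v.1 (-v.1)) (max v.2 (-v.2))) (max (v.1 - v.2) (v.2 - v.1))

lemma hnorm_le_iff {v : Site} {m : ℤ} : hnorm v ≤ m ↔
    -m ≤ v.1 ∧ v.1 ≤ m ∧ -m ≤ v.2 ∧ v.2 ≤ m ∧ v.1 - v.2 ≤ m ∧ v.2 - v.1 ≤ m := by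
  simp only [hnorm, max_le_iff]
  omega

/-- The ball of radius `n` about the origin. -/
noncomputable def ball (n : ℤ) : Finset Site :=
  (Finset.Icc (-n) n ×ˢ Finset.Icc (-n) n).filter fun v => hnorm v ≤ n

lemma mem_ball {n : ℤ} {v : Site} : v ∈ ball n ↔ hnorm v ≤ n := by
  simp only [ball, Finset.mem_filter, Finset.mem_product, Finset.mem_Icc, and_iff_right_iff_imp,
    hnorm_le_iff]
  omega

lemma hnorm_zero : hnorm 0 = 0 := by simp [hnorm]

lemma hnorm_nonneg (v : Site) : 0 ≤ hnorm v := by unfold hnorm; omega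

lemma hnorm_add (v w : Site) : hnorm (v + w) ≤ hnorm v + hnorm w := by
  have h1 := hnorm_le_iff.1 (le_refl (hnorm v))
  have h2 := hnorm_le_iff.1 (le_refl (hnorm w))
  rw [hnorm_le_iff, Prod.fst_add, Prod.snd_add]
  omega

lemma hnorm_sub_le (v w : Site) : hnorm v - hnorm w ≤ hnorm (v - w) := by
  have := hnorm_add (v - w) w
  rw [sub_add_cancel] at this
  omega

lemma hnorm_adj {a b : Site} (h : triAdj a b) : hnorm b ≤ hnorm a + 1 := by
  rw [triAdj_iff] at h
  have h1 := hnorm_le_iff.1 (le_refl (hnorm a))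
  rw [hnorm_le_iff]
  omega

/-- The origin is joined to distance `n`. -/
def arm (n : ℤ) : Set Config :=
  {ω | ∃ v, hnorm v = n ∧ Conn (ball n ∩ openSites ω) 0 v}

lemma isUpperSet_arm (n : ℤ) : IsUpperSet (arm n) :=
  isUpperSet_of_openSites (S := ball n) (P := fun T => ∃ v, hnorm v = n ∧ Conn T 0 v)
    fun _ _ h ⟨v, hv, hc⟩ => ⟨v, hv, hc.mono h⟩

lemma dependsOn_arm (n : ℤ) : DependsOn (· ∈ arm n) (ball n : Set Site) :=
  dependsOn_of_openSites (ball n) fun T => ∃ v, hnorm v = n ∧ Conn T 0 v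

lemma triAdj_add {a b : Site} (y : Site) (h : triAdj a b) : triAdj (a + y) (b + y) := by
  simpa [triAdj] using h

lemma triAdj_sub {a b : Site} (y : Site) (h : triAdj a b) : triAdj (a - y) (b - y) := by
  simpa [triAdj] using h

/-- A connection from `y` to distance `M` of `y` yields a translated arm. -/
lemma mem_arm_of_conn {ω : Config} {S : Set Site} {y v : Site} {M : ℤ} (hM : 0 ≤ M)
    (h : Conn (S ∩ openSites ω) y v) (hv : M ≤ hnorm (v - y)) :
    ω ∘ Equiv.addRight y ∈ arm M := by
  obtain ⟨z, hz, h⟩ := h.hit (f := fun w => hnorm (w - y)) (m := M)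
    (fun a b hab => hnorm_adj (triAdj_sub y hab)) (by simpa [hnorm_zero] using hM) hv
  refine ⟨z - y, hz, ?_⟩
  have := h.map (e := fun w => w - y) (S' := ball M ∩ openSites (ω ∘ Equiv.addRight y))
    (fun a b => triAdj_sub y) (fun w hw => ⟨mem_ball.2 hw.2, by
      have : ω w = true := hw.1.2
      simpa [openSites] using this⟩)
  simpa using this

lemma Pr_translate_arm (p : ℝ) {Λ : Finset Site} {y : Site} {M : ℤ}
    (hΛ : ∀ w, hnorm (w - y) ≤ M → w ∈ Λ) :
    Pr p Λ {ω | ω ∘ Equiv.addRight y ∈ arm M} = Pr p (ball M) (arm M) := by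
  rw [Pr_map]
  refine Pr_congr_of_subset p ?_ (dependsOn_arm M)
  intro w hw
  rw [Finset.mem_map_equiv]
  exact hΛ _ (by simpa [mem_ball] using hw)

/-! ### Exponential decay -/

open scoped Classical in
/-- The sites outside `S` adjacent to `S`. -/
noncomputable def outer (S : Finset Site) : Finset Site :=
  (S.biUnion fun x => ball 1 |>.image (x + ·)).filter fun y => y ∉ S ∧ ∃ x ∈ S, triAdj x y

lemma mem_outer {S : Finset Site} {y : Site} : y ∈ outer S ↔ y ∉ S ∧ ∃ x ∈ S, triAdj x y := by
  classical
  simp only [outer, Finset.mem_filter, and_iff_right_iff_imp, Finset.mem_biUnion,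
    Finset.mem_image, mem_ball]
  rintro ⟨-, x, hx, h⟩
  refine ⟨x, hx, y - x, ?_, by simp⟩
  rw [triAdj_iff] at h
  rw [hnorm_le_iff, Prod.fst_sub, Prod.snd_sub]
  omega

/-- The origin is joined inside `S` to a neighbour of `y`. -/
def toNbr (S : Finset Site) (y : Site) : Set Config :=
  {ω | ∃ x, triAdj x y ∧ Conn (S ∩ openSites ω) 0 x}

lemma isUpperSet_toNbr (S : Finset Site) (y : Site) : IsUpperSet (toNbr S y) :=
  isUpperSet_of_openSites (S := S) (P := fun T => ∃ x, triAdj x y ∧ Conn T 0 x)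
    fun _ _ h ⟨v, hv, hc⟩ => ⟨v, hv, hc.mono h⟩

lemma dependsOn_toNbr (S : Finset Site) (y : Site) : DependsOn (· ∈ toNbr S y) (S : Set Site) :=
  dependsOn_of_openSites S fun T => ∃ x, triAdj x y ∧ Conn T 0 x

/-- The expected number of outer boundary points of `S` reached from the origin inside `S`. -/
noncomputable def psi (p : ℝ) (S : Finset Site) : ℝ := ∑ y ∈ outer S, Pr p S (toNbr S y)

lemma psi_nonneg {p : ℝ} (hp0 : 0 ≤ p) (hp1 : p ≤ 1) (S : Finset Site) : 0 ≤ psi p S :=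
  Finset.sum_nonneg fun _ _ => Pr_nonneg hp0 hp1 _ _

/-- The probability of an arm. -/
noncomputable def theta (p : ℝ) (n : ℤ) : ℝ := Pr p (ball n) (arm n)

lemma theta_step {p : ℝ} (hp0 : 0 ≤ p) (hp1 : p ≤ 1) {S : Finset Site} {L N : ℤ}
    (hS : S ⊆ ball L) (h0 : (0 : Site) ∈ S) (hN : L + 1 ≤ N) :
    theta p N ≤ psi p S * theta p (N - L - 1) := by
  classical
  set Λ := ball N
  have hSΛ : S ⊆ Λ := fun x hx => by
    have := mem_ball.1 (hS hx)
    exact mem_ball.2 (by omega)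
  let T : Finset (Site × Finset Site) :=
    (outer S ×ˢ S.powerset).filter fun q => ∃ x ∈ q.2, triAdj x q.1
  let E : Site × Finset Site → Set Config := fun q =>
    {ω | ∃ v, hnorm v = N ∧
      Conn (((Λ \ (q.2 ∪ fringe {0} S q.2) : Finset Site) : Set Site) ∩ openSites ω) q.1 v}
  have cover : theta p N ≤ ∑ q ∈ T, Pr p Λ ({ω | clus {0} S ω = q.2} ∩ E q) := by
    refine Pr_biUnion_le hp0 hp1 Λ T (arm N) _ fun ω hω => ?_
    obtain ⟨v, hv, hc⟩ := hω
    have h0C : (0 : Site) ∈ clus {0} S ω :=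
      mem_clus.2 ⟨0, rfl, .refl ⟨h0, hc.left_mem.2⟩⟩
    have hvC : v ∉ clus {0} S ω := fun h => by
      have := mem_ball.1 (hS (clus_subset _ _ _ h)); omega
    obtain ⟨x, y, -, hxC, hxy, hy⟩ :=
      hc.last_exit (K := (clus {0} S ω : Set Site)) (by simpa using h0C) (by simpa using hvC)
    have hxC : x ∈ clus {0} S ω := hxC
    have hyS : y ∉ S := fun h => by
      obtain ⟨a, ha, h'⟩ := mem_clus.1 hxC
      exact hy.left_mem.2 (mem_clus.2 ⟨a, ha, h'.tail hxy ⟨h, hy.left_mem.1.2⟩⟩)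
    refine ⟨(y, clus {0} S ω), ?_, rfl, v, hv, ?_⟩
    · simp only [T, Finset.mem_filter, Finset.mem_product, Finset.mem_powerset, mem_outer]
      exact ⟨⟨⟨hyS, x, clus_subset _ _ _ hxC, hxy⟩, clus_subset _ _ _⟩, x, hxC, hxy⟩
    · refine hy.mono fun w hw => ⟨?_, hw.1.2⟩
      simp only [Finset.coe_sdiff, Finset.coe_union, Set.mem_sdiff, Set.mem_union, not_or]
      refine ⟨hw.1.1, hw.2, fun hF => ?_⟩
      have h1 := ((clus_eq_iff (clus_subset {0} S ω) ω).1 rfl).2.1 w hF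
      have h2 : ω w = true := hw.1.2
      simp [h1] at h2
  have indep : ∀ q ∈ T, Pr p Λ ({ω | clus {0} S ω = q.2} ∩ E q) ≤
      Pr p Λ {ω | clus {0} S ω = q.2} * theta p (N - L - 1) := by
    rintro ⟨y, C⟩ hq
    simp only [T, Finset.mem_filter, Finset.mem_product, Finset.mem_powerset, mem_outer] at hq
    obtain ⟨⟨⟨hyS, s, hs, hsy⟩, hCS⟩, -⟩ := hq
    rw [Pr_inter_of_disjoint p Λ (dependsOn_clus_eq hCS)
      (dependsOn_of_openSites (Λ \ (C ∪ fringe {0} S C) : Finset Site)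
        fun T => ∃ v, hnorm v = N ∧ Conn T y v)
      (by
        rw [Set.disjoint_left]
        intro w hw hw'
        simp only [Finset.coe_sdiff, Finset.coe_union, Set.mem_sdiff] at hw'
        exact hw'.2 hw)]
    refine mul_le_mul_of_nonneg_left ?_ (Pr_nonneg hp0 hp1 _ _)
    have hy1 : hnorm y ≤ L + 1 := by
      have := hnorm_adj hsy
      have := mem_ball.1 (hS hs)
      omega
    unfold theta
    rw [← Pr_translate_arm p (Λ := Λ) (y := y)]
    · refine Pr_mono hp0 hp1 Λ ?_
      rintro ω ⟨v, hv, hc⟩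
      refine mem_arm_of_conn (by omega) hc ?_
      have := hnorm_sub_le v y
      omega
    · intro w hw
      have := hnorm_sub_le w y
      exact mem_ball.2 (by omega)
  have sum_le : ∑ q ∈ T, Pr p Λ {ω | clus {0} S ω = q.2} ≤ psi p S := by
    have e : ∑ q ∈ T, Pr p Λ {ω | clus {0} S ω = q.2} =
        ∑ y ∈ outer S, ∑ C ∈ S.powerset with ∃ x ∈ C, triAdj x y,
          Pr p Λ {ω | clus {0} S ω = C} := by
      simp only [T, Finset.sum_filter]
      rw [Finset.sum_product]
    rw [e]
    refine Finset.sum_le_sum fun y hy => ?_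
    rw [← Pr_congr_of_subset p hSΛ (dependsOn_toNbr S y),
      Pr_partition p Λ (toNbr S y) S.powerset (clus {0} S) fun ω =>
        Finset.mem_powerset.2 (clus_subset _ _ _)]
    refine le_trans (Finset.sum_le_sum fun C hC => ?_)
      (Finset.sum_le_sum_of_subset_of_nonneg (Finset.filter_subset _ _) fun C _ _ =>
        Pr_nonneg hp0 hp1 _ _)
    refine Pr_mono hp0 hp1 Λ fun ω hω => ⟨?_, hω⟩
    obtain ⟨-, x, hx, hxy⟩ := Finset.mem_filter.1 hC
    have hω : clus {0} S ω = C := hω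
    rw [← hω] at hx
    obtain ⟨a, rfl, h⟩ := mem_clus.1 hx
    exact ⟨x, hxy, h⟩
  refine cover.trans ((Finset.sum_le_sum indep).trans ?_)
  rw [← Finset.sum_mul]
  exact mul_le_mul_of_nonneg_right sum_le (Pr_nonneg hp0 hp1 _ _)

lemma theta_le_pow {p : ℝ} (hp0 : 0 ≤ p) (hp1 : p ≤ 1) {S : Finset Site} {L : ℤ}
    (hS : S ⊆ ball L) (hL : 0 ≤ L) (h0 : (0 : Site) ∈ S) (k : ℕ) {N : ℤ} (hN : k * (L + 1) ≤ N) :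
    theta p N ≤ psi p S ^ k := by
  induction k generalizing N with
  | zero => simpa [theta] using Pr_le_one hp0 hp1 (ball N) (arm N)
  | succ k ih =>
    push_cast at hN
    have h1 : 0 ≤ (k : ℤ) * (L + 1) := by positivity
    refine (theta_step hp0 hp1 hS h0 (by nlinarith)).trans ?_
    rw [pow_succ']
    exact mul_le_mul_of_nonneg_left (ih (by nlinarith)) (psi_nonneg hp0 hp1 S)

end TriPerc

namespace TriPerc

open Function Relation

/-! ### The differential inequality -/

lemma mem_arm_iff {n : ℤ} {ω : Config} :
    ω ∈ arm n ↔ (0 : Site) ∈ clus {v | hnorm v = n} (ball n) ω := by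
  rw [mem_clus]
  exact ⟨fun ⟨v, hv, h⟩ => ⟨v, hv, h.symm⟩, fun ⟨v, hv, h⟩ => ⟨v, hv, h.symm⟩⟩

/-- Opening a site of the fringe of the cluster of the sphere, adjacent to the part of the cluster
of the origin avoiding that fringe, creates an arm. -/
lemma update_mem_arm {n : ℤ} {ω : Config} {v : Site}
    (hv : v ∈ fringe {v | hnorm v = n} (ball n) (clus {v | hnorm v = n} (ball n) ω))
    (h : v = 0 ∨ ∃ x, triAdj x v ∧ Conn (ball n ∩ openSites ω) 0 x) : update ω v true ∈ arm n := by
  have hle : openSites ω ⊆ openSites (update ω v true) := by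
    intro w hw
    by_cases hwv : w = v
    · subst hwv; simp [openSites]
    · simpa [openSites, hwv] using hw
  have hvo : v ∈ openSites (update ω v true) := by simp [openSites]
  rw [mem_fringe] at hv
  have hvb : v ∈ (ball n : Set Site) ∩ openSites (update ω v true) := ⟨hv.1, hvo⟩
  have h0 : Conn (ball n ∩ openSites (update ω v true)) 0 v := by
    rcases h with rfl | ⟨x, hx, h⟩
    · exact .refl hvb
    · exact (h.mono (Set.inter_subset_inter_right _ hle)).tail hx hvb
  rcases hv.2.2 with ha | ⟨x, hx, hxv⟩
  · exact ⟨v, ha, h0⟩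
  · obtain ⟨a, ha, hc⟩ := mem_clus.1 hx
    exact ⟨a, ha, h0.trans ((hc.mono (Set.inter_subset_inter_right _ hle)).tail hxv hvb).symm⟩

open scoped Classical in
/-- A lower bound for the number of pivotal sites when the cluster of the sphere is `K`. -/
noncomputable def pivBound (n : ℤ) (K : Finset Site) (ω : Config) : ℝ :=
  if (0 : Site) ∈ ball n \ (K ∪ fringe {v | hnorm v = n} (ball n) K) then
    ∑ y ∈ outer (ball n \ (K ∪ fringe {v | hnorm v = n} (ball n) K)),
      (toNbr (ball n \ (K ∪ fringe {v | hnorm v = n} (ball n) K)) y).indicator (fun _ => (1 : ℝ)) ω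
  else 1

open scoped Classical in
lemma pivBound_le {n : ℤ} (hn : 0 ≤ n) {ω : Config} (h0 : ω ∉ arm n) :
    pivBound n (clus {v | hnorm v = n} (ball n) ω) ω ≤ ∑ v ∈ ball n,
      ((arm n).indicator (fun _ => (1 : ℝ)) (update ω v true) -
        (arm n).indicator (fun _ => (1 : ℝ)) (update ω v false)) := by
  set K := clus {v | hnorm v = n} (ball n) ω with hK
  set F := fringe {v | hnorm v = n} (ball n) K with hF
  have term_nonneg : ∀ v, 0 ≤ (arm n).indicator (fun _ => (1 : ℝ)) (update ω v true) -
        (arm n).indicator (fun _ => (1 : ℝ)) (update ω v false) := fun v =>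
    sub_nonneg.2 (monotone_indicator (isUpperSet_arm n)
      (update_le_update_iff.2 ⟨by decide, fun w _ => le_rfl⟩))
  have hclosed : ∀ v ∈ F, ω v = false := ((clus_eq_iff (clus_subset _ _ _) ω).1 hK.symm).2.1
  have piv : ∀ v ∈ F, (v = 0 ∨ ∃ x, triAdj x v ∧ Conn (ball n ∩ openSites ω) 0 x) →
      (1 : ℝ) = (arm n).indicator (fun _ => (1 : ℝ)) (update ω v true) -
        (arm n).indicator (fun _ => (1 : ℝ)) (update ω v false) := by
    intro v hv h
    have e : update ω v false = ω := by rw [← hclosed v hv]; exact update_eq_self v ω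
    rw [e, Set.indicator_of_mem (update_mem_arm hv h), Set.indicator_of_notMem h0, sub_zero]
  have hFb : F ⊆ ball n := fun v hv => (mem_fringe.1 hv).1
  have h0K : (0 : Site) ∉ K := fun h => h0 (mem_arm_iff.2 h)
  unfold pivBound
  rw [← hF]
  split_ifs with hS
  · have hout : outer (ball n \ (K ∪ F)) ⊆ F := by
      intro y hy
      obtain ⟨hy, s, hs, hsy⟩ := mem_outer.1 hy
      simp only [Finset.mem_sdiff, Finset.mem_union, not_or, not_and, mem_ball] at hs hy
      have hsn : hnorm s ≠ n := fun h =>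
        hs.2.2 (mem_fringe.2 ⟨mem_ball.2 hs.1, hs.2.1, Or.inl h⟩)
      have hyb : hnorm y ≤ n := by have := hnorm_adj hsy; omega
      by_contra hyF
      apply hs.2.2
      have hyK : y ∈ K := by
        by_contra hyK
        exact hy hyb hyK hyF
      exact mem_fringe.2 ⟨mem_ball.2 hs.1, hs.2.1, Or.inr ⟨y, hyK, adj_symm hsy⟩⟩
    refine (Finset.sum_le_sum fun y hy => ?_).trans
      (Finset.sum_le_sum_of_subset_of_nonneg (hout.trans hFb) fun v _ _ => term_nonneg v)
    by_cases hyt : ω ∈ toNbr (ball n \ (K ∪ F)) y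
    · rw [Set.indicator_of_mem hyt, ← piv y (hout hy)]
      obtain ⟨x, hx, h⟩ := hyt
      exact Or.inr ⟨x, hx, h.mono (Set.inter_subset_inter_left _ fun w hw =>
        (Finset.mem_sdiff.1 hw).1)⟩
    · rw [Set.indicator_of_notMem hyt]
      exact term_nonneg y
  · have h0F : (0 : Site) ∈ F := by
      simp only [Finset.mem_sdiff, Finset.mem_union, not_and, not_not, mem_ball, hnorm_zero] at hS
      exact (hS hn).resolve_left h0K
    refine (piv 0 h0F (Or.inl rfl)).le.trans ?_
    exact Finset.single_le_sum
      (f := fun v => (arm n).indicator (fun _ => (1 : ℝ)) (update ω v true) -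
        (arm n).indicator (fun _ => (1 : ℝ)) (update ω v false))
      (fun v _ => term_nonneg v) (hFb h0F)

lemma theta_hasDerivAt (p : ℝ) (n : ℤ) : HasDerivAt (fun p => theta p n)
    (∑ v ∈ ball n, Ex p (ball n) (fun ω =>
      (arm n).indicator (fun _ => (1 : ℝ)) (update ω v true) -
        (arm n).indicator (fun _ => (1 : ℝ)) (update ω v false))) p :=
  Ex_hasDerivAt p (ball n) _

open scoped Classical in
lemma le_theta_deriv {p : ℝ} (hp0 : 0 ≤ p) (hp1 : p ≤ 1)
    (hpsi : ∀ S : Finset Site, (0 : Site) ∈ S → 1 ≤ psi p S) {n : ℤ} (hn : 0 ≤ n) :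
    1 - theta p n ≤ ∑ v ∈ ball n, Ex p (ball n) (fun ω =>
      (arm n).indicator (fun _ => (1 : ℝ)) (update ω v true) -
        (arm n).indicator (fun _ => (1 : ℝ)) (update ω v false)) := by
  set Λ := ball n
  set A : Set Site := {v | hnorm v = n}
  have h1 : 1 - theta p n = ∑ K ∈ Λ.powerset, Pr p Λ ((arm n)ᶜ ∩ {ω | clus A Λ ω = K}) := by
    rw [theta, ← Pr_compl]
    exact Pr_partition p Λ _ _ _ fun ω => Finset.mem_powerset.2 (clus_subset _ _ _)
  have h2 : ∀ K ∈ Λ.powerset, Pr p Λ ((arm n)ᶜ ∩ {ω | clus A Λ ω = K}) ≤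
      Ex p Λ (fun ω => ((arm n)ᶜ ∩ {ω | clus A Λ ω = K}).indicator (fun _ => (1 : ℝ)) ω *
        pivBound n K ω) := by
    intro K hK
    have hKΛ := Finset.mem_powerset.1 hK
    by_cases h0K : (0 : Site) ∈ K
    · have : (arm n)ᶜ ∩ {ω | clus A Λ ω = K} = ∅ := by
        ext ω
        simp only [Set.mem_inter_iff, Set.mem_compl_iff, Set.mem_ofPred_eq, Set.mem_empty_iff_false,
          iff_false, not_and]
        rintro h rfl
        exact h (mem_arm_iff.2 h0K)
      simp [this, Pr, Ex_const]
    have hE : (arm n)ᶜ ∩ {ω | clus A Λ ω = K} = {ω | clus A Λ ω = K} := by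
      refine Set.inter_eq_right.2 ?_
      rintro ω rfl h
      exact h0K (mem_arm_iff.1 h)
    rw [hE]
    unfold pivBound
    split_ifs with hS
    · simp only [Finset.mul_sum]
      rw [Ex_sum]
      have hdis : Disjoint ((K : Set Site) ∪ fringe A Λ K)
          ((Λ \ (K ∪ fringe A Λ K) : Finset Site) : Set Site) := by
        rw [Set.disjoint_left]
        intro w hw hw'
        simp only [Finset.coe_sdiff, Finset.coe_union, Set.mem_sdiff] at hw'
        exact hw'.2 hw
      have e : ∀ y, Ex p Λ (fun ω => ({ω | clus A Λ ω = K} : Set Config).indicator (fun _ => 1) ω *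
          (toNbr (Λ \ (K ∪ fringe A Λ K)) y).indicator (fun _ => (1 : ℝ)) ω) =
          Pr p Λ {ω | clus A Λ ω = K} *
            Pr p (Λ \ (K ∪ fringe A Λ K)) (toNbr (Λ \ (K ∪ fringe A Λ K)) y) := by
        intro y
        rw [Ex_mul_of_disjoint p Λ (dependsOn_indicator (dependsOn_clus_eq hKΛ))
          (dependsOn_indicator (dependsOn_toNbr _ y)) hdis]
        congr 1
        exact Pr_congr_of_subset p Finset.sdiff_subset (dependsOn_toNbr _ y)
      rw [Finset.sum_congr rfl fun y _ => e y, ← Finset.mul_sum]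
      exact le_mul_of_one_le_right (Pr_nonneg hp0 hp1 _ _) (hpsi _ hS)
    · simp only [mul_one]; exact le_rfl
  rw [h1]
  refine (Finset.sum_le_sum h2).trans ?_
  rw [← Ex_sum, ← Ex_sum]
  refine Ex_mono hp0 hp1 Λ fun ω => ?_
  by_cases h0 : ω ∈ arm n
  · have : ∀ K ∈ Λ.powerset, ((arm n)ᶜ ∩ {ω | clus A Λ ω = K}).indicator (fun _ => (1 : ℝ)) ω *
        pivBound n K ω = 0 := fun K _ => by
      rw [Set.indicator_of_notMem (fun h => h.1 h0), zero_mul]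
    rw [Finset.sum_eq_zero this]
    exact Finset.sum_nonneg fun v _ => sub_nonneg.2 (monotone_indicator (isUpperSet_arm n)
      (update_le_update_iff.2 ⟨by decide, fun w _ => le_rfl⟩))
  · rw [Finset.sum_eq_single (clus A Λ ω)]
    · have hm : ω ∈ (arm n)ᶜ ∩ {ω' | clus A Λ ω' = clus A Λ ω} := ⟨h0, rfl⟩
      rw [Set.indicator_of_mem hm, one_mul]
      exact pivBound_le hn h0
    · intro K _ hK
      rw [Set.indicator_of_notMem (fun h => hK h.2.symm), zero_mul]
    · intro h
      exact absurd (Finset.mem_powerset.2 (clus_subset A Λ ω)) h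

lemma theta_mono {s q : ℝ} (hs : 0 ≤ s) (hsq : s ≤ q) (hq : q ≤ 1) (n : ℤ) :
    theta s n ≤ theta q n := Pr_mono_param hs hsq hq _ (isUpperSet_arm n)

lemma psi_mono {s q : ℝ} (hs : 0 ≤ s) (hsq : s ≤ q) (hq : q ≤ 1) (S : Finset Site) :
    psi s S ≤ psi q S :=
  Finset.sum_le_sum fun y _ => Pr_mono_param hs hsq hq _ (isUpperSet_toNbr S y)

/-- If `psi q S ≥ 1` for every `S`, arms have probability bounded below beyond `q`. -/
theorem theta_lower_bound {q r : ℝ} (hq : 0 ≤ q) (hqr : q < r) (hr : r ≤ 1)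
    (hpsi : ∀ S : Finset Site, (0 : Site) ∈ S → 1 ≤ psi q S) {n : ℤ} (hn : 0 ≤ n) :
    (r - q) / (1 + (r - q)) ≤ theta r n := by
  obtain ⟨x, hx, hd⟩ := exists_hasDerivAt_eq_slope (fun p => theta p n) _ hqr
    (fun p _ => (theta_hasDerivAt p n).continuousAt.continuousWithinAt)
    fun p _ => theta_hasDerivAt p n
  have hx0 : 0 ≤ x := by linarith [hx.1]
  have hx1 : x ≤ 1 := by linarith [hx.2]
  have h1 := le_theta_deriv hx0 hx1
    (fun S hS => (hpsi S hS).trans (psi_mono hq hx.1.le hx1 S)) hn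
  rw [hd, le_div_iff₀ (by linarith)] at h1
  have h2 := theta_mono hx0 hx.2.le hr n
  have h3 : 0 ≤ theta q n := Pr_nonneg hq (by linarith) _ _
  rw [div_le_iff₀ (by linarith)]
  nlinarith

end TriPerc

namespace TriPerc

open Function Relation Filter

/-! ### Symmetries and events of uniformly positive probability -/

/-- `e` is an automorphism of the triangular lattice with inverse `e'`. -/
structure IsSymm (e e' : Site → Site) : Prop where
  left : ∀ w, e' (e w) = w
  right : ∀ w, e (e' w) = w
  adj : ∀ a b, triAdj a b → triAdj (e a) (e b)

lemma isSymm_of_coord {e e' : Site → Site} (h1 : ∀ x y, e' (e (x, y)) = (x, y))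
    (h2 : ∀ x y, e (e' (x, y)) = (x, y))
    (h3 : ∀ x y x' y', triAdj (x, y) (x', y') → triAdj (e (x, y)) (e (x', y'))) : IsSymm e e' :=
  ⟨fun w => h1 w.1 w.2, fun w => h2 w.1 w.2, fun a b => h3 a.1 a.2 b.1 b.2⟩

lemma isSymm_translate (y : Site) : IsSymm (fun w => w + y) (fun w => w - y) :=
  ⟨fun w => by simp, fun w => by simp, fun _ _ => triAdj_add y⟩

lemma IsSymm.comp {e e' f f' : Site → Site} (he : IsSymm e e') (hf : IsSymm f f') :
    IsSymm (fun w => f (e w)) (fun w => e' (f' w)) :=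
  ⟨fun w => by rw [hf.left, he.left], fun w => by rw [he.right, hf.right],
    fun _ _ h => hf.adj _ _ (he.adj _ _ h)⟩

/-- `u` is joined to a site of `B` by an open path in `S`. -/
def J (S : Set Site) (u : Site) (B : Set Site) : Set Config :=
  {ω | ∃ v ∈ B, Conn (S ∩ openSites ω) u v}

lemma isUpperSet_J (S : Set Site) (u : Site) (B : Set Site) : IsUpperSet (J S u B) :=
  isUpperSet_of_openSites (S := S) (P := fun T => ∃ v ∈ B, Conn T u v)
    fun _ _ h ⟨v, hv, hc⟩ => ⟨v, hv, hc.mono h⟩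

lemma dependsOn_J (S : Set Site) (u : Site) (B : Set Site) : DependsOn (· ∈ J S u B) S :=
  dependsOn_of_openSites S fun T => ∃ v ∈ B, Conn T u v

/-- Increasing events which have critical probability at least `c` in large volumes. -/
def Good (c : ℝ) (A : Set Config) : Prop :=
  IsUpperSet A ∧ ∀ᶠ Λ : Finset Site in atTop, c ≤ Pr (1 / 2) Λ A

lemma half_nonneg : (0 : ℝ) ≤ 1 / 2 := by norm_num
lemma half_le_one : (1 / 2 : ℝ) ≤ 1 := by norm_num

namespace Good

variable {c c' : ℝ} {A B : Set Config}

lemma mono (h : Good c A) (hB : IsUpperSet B) (hAB : A ⊆ B) : Good c B :=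
  ⟨hB, h.2.mono fun _ hΛ => hΛ.trans (Pr_mono half_nonneg half_le_one _ hAB)⟩

lemma inter (h : Good c A) (h' : Good c' B) (hc : 0 ≤ c) (hc' : 0 ≤ c') :
    Good (c * c') (A ∩ B) :=
  ⟨h.1.inter h'.1, by
    filter_upwards [h.2, h'.2] with Λ h1 h2
    exact (mul_le_mul h1 h2 hc' (hc.trans h1)).trans
      (Pr_harris half_nonneg half_le_one Λ h.1 h'.1)⟩

lemma image {S S' B B' : Set Site} {u u' : Site} (h : Good c (J S u B)) {e e' : Site → Site}
    (he : IsSymm e e') (hu : e u = u') (hS : ∀ w ∈ S, e w ∈ S') (hB : ∀ w ∈ B, e w ∈ B') :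
    Good c (J S' u' B') := by
  let f : Site ≃ Site := ⟨e, e', he.left, he.right⟩
  refine ⟨isUpperSet_J _ _ _, ?_⟩
  have ht : Tendsto (fun Λ : Finset Site => Λ.map f.symm.toEmbedding) atTop atTop := by
    refine tendsto_atTop.2 fun Λ₀ => ?_
    filter_upwards [eventually_ge_atTop (Λ₀.map f.toEmbedding)] with Λ hΛ
    intro w hw
    rw [Finset.mem_map_equiv]
    exact hΛ (by simpa using hw)
  filter_upwards [ht.eventually h.2] with Λ hΛ
  rw [← Pr_map] at hΛ
  refine hΛ.trans (Pr_mono half_nonneg half_le_one Λ ?_)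
  rintro ω ⟨v, hv, hc⟩
  subst hu
  exact ⟨e v, hB v hv, hc.map he.adj fun w hw => ⟨hS w hw.1, hw.2⟩⟩

lemma iff_le {D : Finset Site} (hA : IsUpperSet A) (hD : DependsOn (· ∈ A) (D : Set Site)) :
    Good c A ↔ c ≤ Pr (1 / 2) D A := by
  constructor
  · rintro ⟨-, h⟩
    obtain ⟨Λ, h1, h2⟩ := (h.and (eventually_ge_atTop D)).exists
    rwa [Pr_congr_of_subset _ h2 hD] at h1
  · intro h
    refine ⟨hA, ?_⟩
    filter_upwards [eventually_ge_atTop D] with Λ hΛ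
    rwa [Pr_congr_of_subset _ hΛ hD]

/-- Concatenation of connections. -/
lemma trans {S S' T B : Set Site} {u v : Site} (h : Good c (J S u {v})) (h' : Good c' (J S' v B))
    (hc : 0 ≤ c) (hc' : 0 ≤ c') (hS : S ⊆ T) (hS' : S' ⊆ T) : Good (c * c') (J T u B) := by
  refine (h.inter h' hc hc').mono (isUpperSet_J _ _ _) ?_
  rintro ω ⟨⟨_, rfl, h1⟩, ⟨w, hw, h2⟩⟩
  exact ⟨w, hw, (h1.mono (Set.inter_subset_inter_left _ hS)).trans
    (h2.mono (Set.inter_subset_inter_left _ hS'))⟩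

end Good

/-- The upper part of the right side of the ball. -/
def sideHigh (n β : ℤ) : Set Site := {v | v.1 = n ∧ β ≤ 2 * v.2 - n}

/-- The sites of the right side of the ball close to its middle. -/
def sideLow (n β : ℤ) : Set Site := {v | v.1 = n ∧ 0 ≤ 2 * v.2 - n ∧ 2 * v.2 - n ≤ β}

/-- The closed form of the twelve symmetries fixing the origin. -/
def sym12 : Fin 12 → Site → Site := ![
  fun v => (v.1, v.2), fun v => (v.1 - v.2, v.1), fun v => (-v.2, v.1 - v.2),
  fun v => (-v.1, -v.2), fun v => (v.2 - v.1, -v.1), fun v => (v.2, v.2 - v.1),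
  fun v => (v.1, v.1 - v.2), fun v => (v.1 - v.2, -v.2), fun v => (-v.2, -v.1),
  fun v => (-v.1, v.2 - v.1), fun v => (v.2 - v.1, v.2), fun v => (v.2, v.1)]

/-- The inverses of the symmetries `sym12`. -/
def sym12inv : Fin 12 → Site → Site := ![
  fun v => (v.1, v.2), fun v => (v.2, v.2 - v.1), fun v => (v.2 - v.1, -v.1),
  fun v => (-v.1, -v.2), fun v => (-v.2, v.1 - v.2), fun v => (v.1 - v.2, v.1),
  fun v => (v.1, v.1 - v.2), fun v => (v.1 - v.2, -v.2), fun v => (-v.2, -v.1),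
  fun v => (-v.1, v.2 - v.1), fun v => (v.2 - v.1, v.2), fun v => (v.2, v.1)]

lemma isSymm_sym12 (i : Fin 12) : IsSymm (sym12 i) (sym12inv i) := by
  refine isSymm_of_coord (fun x y => ?_) (fun x y => ?_) fun x y x' y' h => ?_
  · fin_cases i <;> simp [sym12, sym12inv]
  · fin_cases i <;> simp [sym12, sym12inv]
  · rw [triAdj_iff] at h
    simp only at h
    rcases h with h | h | h | h | h | h <;> fin_cases i <;>
      refine triAdj_iff.2 ?_ <;>
      simp only [sym12, Matrix.cons_val_zero, Matrix.cons_val,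
        Fin.mk_one, Fin.zero_eta, Fin.reduceFinMk] <;> omega

lemma sym12_zero (i : Fin 12) : sym12 i 0 = 0 := by
  fin_cases i <;> simp [sym12]

lemma hnorm_sym12 (i : Fin 12) {v : Site} {n : ℤ} (h : hnorm v ≤ n) : hnorm (sym12 i v) ≤ n := by
  rw [hnorm_le_iff] at h
  fin_cases i <;> refine hnorm_le_iff.2 ?_ <;>
    simp only [sym12, Matrix.cons_val_zero, Matrix.cons_val,
        Fin.mk_one, Fin.zero_eta, Fin.reduceFinMk] <;> omega

lemma exists_sym12 {v : Site} {n : ℤ} (h : hnorm v = n) : ∃ i, sym12 i v ∈ sideHigh n 0 := by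
  have h1 := hnorm_le_iff.1 h.le
  have h2 : ¬ hnorm v ≤ n - 1 := by omega
  rw [hnorm_le_iff] at h2
  obtain ⟨x, y⟩ := v
  simp only at h1 h2
  have key : ∀ i z w, sym12 i (x, y) = (z, w) → z = n → n ≤ 2 * w →
      ∃ i, sym12 i (x, y) ∈ sideHigh n 0 := by
    intro i z w hi hz hw
    refine ⟨i, ?_⟩
    rw [hi]
    exact ⟨hz, by omega⟩
  by_contra hc
  have hx : x = n ∨ x = -n ∨ y = n ∨ y = -n ∨ x - y = n ∨ y - x = n := by omega
  rcases hx with hx | hx | hx | hx | hx | hx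
  · by_cases hs : n ≤ 2 * y
    · exact hc (key 0 _ _ rfl (by omega) (by omega))
    · exact hc (key 6 _ _ rfl (by omega) (by omega))
  · by_cases hs : n ≤ -2 * y
    · exact hc (key 3 _ _ rfl (by omega) (by omega))
    · exact hc (key 9 _ _ rfl (by omega) (by omega))
  · by_cases hs : n ≤ 2 * x
    · exact hc (key 11 _ _ rfl (by omega) (by omega))
    · exact hc (key 5 _ _ rfl (by omega) (by omega))
  · by_cases hs : n ≤ -2 * x
    · exact hc (key 8 _ _ rfl (by omega) (by omega))
    · exact hc (key 2 _ _ rfl (by omega) (by omega))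
  · by_cases hs : n ≤ 2 * x
    · exact hc (key 1 _ _ rfl (by omega) (by omega))
    · exact hc (key 7 _ _ rfl (by omega) (by omega))
  · by_cases hs : n ≤ -2 * x
    · exact hc (key 4 _ _ rfl (by omega) (by omega))
    · exact hc (key 10 _ _ rfl (by omega) (by omega))

/-- The choice of the height splitting the right side into two parts of comparable
probability. -/
lemma exists_height {c : ℝ} (hc : 0 < c) (n : ℤ) (hn : 0 ≤ n) (h : c ≤ theta (1 / 2) n) :
    ∃ β, 0 ≤ β ∧ β ≤ n ∧ Good (c / 24) (J (ball n) 0 (sideHigh n β)) ∧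
      Good (c / 24) (J (ball n) 0 (sideLow n β)) := by
  classical
  have giff : ∀ (c : ℝ) B, Good c (J (ball n) 0 B) ↔ c ≤ Pr (1 / 2) (ball n) (J (ball n) 0 B) :=
    fun c B => Good.iff_le (isUpperSet_J _ _ _) (dependsOn_J _ _ _)
  simp only [giff]
  set P : ℤ → ℝ := fun β => Pr (1 / 2) (ball n) (J (ball n) 0 (sideHigh n β)) with hP
  have h0 : c / 12 ≤ P 0 := by
    have hi : ∀ i, Pr (1 / 2) (ball n) (J (ball n) 0 {v | sym12 i v ∈ sideHigh n 0}) ≤ P 0 := by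
      intro i
      rw [hP, ← giff]
      exact ((giff _ _).2 le_rfl).image (isSymm_sym12 i) (sym12_zero i)
        (fun w hw => mem_ball.2 (hnorm_sym12 i (mem_ball.1 hw))) fun w hw => hw
    have hu : theta (1 / 2) n ≤ ∑ i : Fin 12,
        Pr (1 / 2) (ball n) (J (ball n) 0 {v | sym12 i v ∈ sideHigh n 0}) := by
      refine Pr_biUnion_le half_nonneg half_le_one _ _ (arm n) _ ?_
      rintro ω ⟨v, hv, hω⟩
      obtain ⟨i, hi⟩ := exists_sym12 hv
      exact ⟨i, Finset.mem_univ _, v, hi, hω⟩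
    have := hu.trans (Finset.sum_le_sum fun i _ => hi i)
    simp only [Finset.sum_const, Finset.card_univ, Fintype.card_fin, nsmul_eq_mul] at this
    push_cast at this
    linarith
  obtain ⟨β, hβ, hmax⟩ := Finset.exists_max_image
    ((Finset.Icc 0 n).filter fun β => c / 24 ≤ P β) id ⟨0, by
      simp only [Finset.mem_filter, Finset.mem_Icc]
      exact ⟨⟨le_rfl, hn⟩, by linarith⟩⟩
  simp only [Finset.mem_filter, Finset.mem_Icc, id] at hβ hmax
  refine ⟨β, hβ.1.1, hβ.1.2, hβ.2, ?_⟩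
  have hlt : P (β + 1) < c / 24 := by
    by_contra hge
    push Not at hge
    by_cases hβn : β + 1 ≤ n
    · have := hmax (β + 1) ⟨⟨by omega, hβn⟩, hge⟩
      omega
    · have : J (ball n) 0 (sideHigh n (β + 1)) = ∅ := by
        rw [Set.eq_empty_iff_forall_notMem]
        rintro ω ⟨v, hv, hω⟩
        have h1 := hnorm_le_iff.1 (mem_ball.1 hω.right_mem.1)
        have h2 : v.1 = n := hv.1
        have h3 : β + 1 ≤ 2 * v.2 - n := hv.2
        omega
      simp only [hP, this] at hge
      simp only [Pr, Set.indicator_empty, Ex_const] at hge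
      linarith
  have hsplit : P 0 ≤ ∑ b : Bool, Pr (1 / 2) (ball n)
      (J (ball n) 0 (if b then sideLow n β else sideHigh n (β + 1))) := by
    refine Pr_biUnion_le half_nonneg half_le_one _ _ _ _ ?_
    rintro ω ⟨v, hv, hω⟩
    by_cases hvβ : 2 * v.2 - n ≤ β
    · exact ⟨true, Finset.mem_univ _, v, by simpa using ⟨hv.1, hv.2, hvβ⟩, hω⟩
    · exact ⟨false, Finset.mem_univ _, v, by simpa using ⟨hv.1, by omega⟩, hω⟩
  simp only [Fintype.sum_bool, if_true, Bool.false_eq_true, if_false] at hsplit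
  change P 0 ≤ _ + P (β + 1) at hsplit
  linarith

end TriPerc

namespace TriPerc

open Function Relation Filter

/-! ### Gluing of critical connections -/

/-- Two arms from `0` and two arms from `(0, β)` force a connection between these points. -/
lemma link {n β : ℤ} (hn : 0 ≤ n) (hβ : 0 ≤ β) {O : Set Site} {p₁ p₂ p₃ p₄ : Site}
    (h₁ : Conn (ball n ∩ O) 0 p₁) (e₁ : p₁.1 = -n) (f₁ : β ≤ 2 * p₁.2 + n)
    (h₂ : Conn (ball n ∩ O) 0 p₂) (e₂ : p₂.2 = -n)
    (h₃ : Conn ({w | hnorm (w - (0, β)) ≤ n} ∩ O) (0, β) p₃) (e₃ : p₃.1 = -n)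
    (f₃ : 2 * (p₃.2 - β) + n ≤ -β)
    (h₄ : Conn ({w | hnorm (w - (0, β)) ≤ n} ∩ O) (0, β) p₄) (e₄ : p₄.1 = n) :
    Conn ((ball n ∪ {w | hnorm (w - (0, β)) ≤ n}) ∩ O) 0 (0, β) := by
  have glue : ∀ w, Conn (ball n ∩ O) 0 w → Conn ({w | hnorm (w - (0, β)) ≤ n} ∩ O) (0, β) w →
      Conn ((ball n ∪ {w | hnorm (w - (0, β)) ≤ n}) ∩ O) 0 (0, β) := fun w a b =>
    (a.mono (Set.inter_subset_inter_left _ Set.subset_union_left)).trans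
      (b.symm.mono (Set.inter_subset_inter_left _ Set.subset_union_right))
  have i₀ : ∀ w, Conn (ball n ∩ O) 0 w → -n ≤ w.1 ∧ w.1 ≤ n ∧ -n ≤ w.2 ∧ w.2 ≤ n := by
    intro w hw
    have := hnorm_le_iff.1 (mem_ball.1 hw.right_mem.1)
    omega
  have iz : ∀ w, Conn ({w | hnorm (w - (0, β)) ≤ n} ∩ O) (0, β) w →
      -n ≤ w.1 ∧ w.1 ≤ n ∧ β - n ≤ w.2 ∧ w.2 ≤ β + n := by
    intro w hw
    have := hnorm_le_iff.1 hw.right_mem.1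
    simp only [Prod.fst_sub, Prod.snd_sub] at this
    omega
  obtain ⟨x₁, y₁⟩ := p₁
  obtain ⟨x₂, y₂⟩ := p₂
  obtain ⟨x₃, y₃⟩ := p₃
  obtain ⟨x₄, y₄⟩ := p₄
  simp only at e₁ f₁ e₂ e₃ f₃ e₄
  subst e₁ e₂ e₃ e₄
  have j₁ := i₀ _ h₁
  have j₂ := i₀ _ h₂
  have j₃ := iz _ h₃
  have j₄ := iz _ h₄
  simp only at j₁ j₂ j₃ j₄
  by_cases he : y₃ = y₁
  · subst he
    exact glue _ h₁ h₃
  set G : Set Site := {w | Conn ({w | hnorm (w - (0, β)) ≤ x₄} ∩ O) (0, β) w} ∪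
    {w | w.2 = y₃ ∧ (w.1 = -x₄ - 1 ∨ w.1 = -x₄ - 2)} ∪ {(x₄ + 1, y₄)} with hG
  set D : Set Site := {w | Conn (ball x₄ ∩ O) 0 w} ∪
    {w | w.1 = -x₄ - 1 ∧ y₁ ≤ w.2} ∪ {(x₂, -x₄ - 1)} with hD
  have cG : Conn G (-x₄ - 2, y₃) (x₄ + 1, y₄) := by
    have a₁ : Conn G (-x₄ - 2, y₃) (-x₄ - 1, y₃) :=
      .of_adj (.inl (.inr ⟨rfl, .inr rfl⟩)) (triAdj_iff.2 (by dsimp only; omega))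
        (.inl (.inr ⟨rfl, .inl rfl⟩))
    have a₂ := a₁.tail (w := (-x₄, y₃)) (triAdj_iff.2 (by dsimp only; omega)) (.inl (.inl h₃))
    have s : {w | Conn ({w | hnorm (w - (0, β)) ≤ x₄} ∩ O) (0, β) w} ⊆ G := fun w hw =>
      .inl (.inl hw)
    exact ((a₂.trans (h₃.cluster.symm.mono s)).trans (h₄.cluster.mono s)).tail
      (triAdj_iff.2 (by dsimp only; omega)) (.inr rfl)
  have cD : Conn D (-x₄ - 1, x₄ + β + 1) (x₂, -x₄ - 1) := by
    have a₁ : Conn D (-x₄ - 1, y₁) (-x₄ - 1, x₄ + β + 1) :=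
      .vert (by omega) fun z hz _ => .inl (.inr ⟨rfl, hz⟩)
    have a₂ := a₁.symm.tail (w := (-x₄, y₁)) (triAdj_iff.2 (by dsimp only; omega)) (.inl (.inl h₁))
    have s : {w | Conn (ball x₄ ∩ O) 0 w} ⊆ D := fun w hw => .inl (.inl hw)
    exact ((a₂.trans (h₁.cluster.symm.mono s)).trans (h₂.cluster.mono s)).tail
      (triAdj_iff.2 (by dsimp only; omega)) (.inr rfl)
  obtain ⟨w, wG, wD⟩ := crossing (a := -x₄ - 1) (b := x₄) (c := -x₄ - 1) (d := x₄ + β + 1) cG cD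
    (by simp only; omega) (by simp only; omega)
    (by
      rintro w ((hw | hw) | hw)
      · have := iz _ hw
        omega
      · have := hw.1
        omega
      · have := congrArg Prod.snd hw
        simp only at this
        omega)
    (by
      rintro w ((hw | hw) | hw)
      · have := i₀ _ hw
        omega
      · have := hw.1
        omega
      · have := congrArg Prod.fst hw
        simp only at this
        omega)
    le_rfl le_rfl
  rcases wG with (wG | wG) | wG <;> rcases wD with (wD | wD) | wD
  · exact glue _ wD wG
  · have := iz _ wG
    have := wD.1
    omega
  · have := iz _ wG
    have := congrArg Prod.snd wD
    simp only at this
    omega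
  · have := i₀ _ wD
    have := wG.2
    omega
  · have := wG.1
    have := wD.2
    omega
  · have := wG.1
    have := congrArg Prod.snd wD
    simp only at this
    omega
  · have := i₀ _ wD
    have := congrArg Prod.fst wG
    simp only at this
    omega
  · have := wD.1
    have := congrArg Prod.fst wG
    simp only at this
    omega
  · have := congrArg Prod.fst wG
    have := congrArg Prod.fst wD
    simp only at *
    omega

lemma good_link {a : ℝ} {n β : ℤ} (ha : 0 ≤ a) (hn : 0 ≤ n) (hβ : 0 ≤ β)
    (h : Good a (J (ball n) 0 (sideHigh n β))) :
    Good (a ^ 4) (J (ball n ∪ {w | hnorm (w - (0, β)) ≤ n}) 0 {(0, β)}) := by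
  have hb : ∀ i, ∀ w ∈ (ball n : Set Site), sym12 i w ∈ (ball n : Set Site) := fun i w hw =>
    mem_ball.2 (hnorm_sym12 i (mem_ball.1 hw))
  have g₁ : Good a (J (ball n) 0 {v | v.1 = -n ∧ β ≤ 2 * v.2 + n}) := by
    refine h.image (isSymm_sym12 9) (sym12_zero 9) (hb 9) ?_
    rintro w ⟨h1, h2⟩
    change -w.1 = -n ∧ β ≤ 2 * (w.2 - w.1) + n
    omega
  have g₂ : Good a (J (ball n) 0 {v | v.2 = -n}) := by
    refine h.image (isSymm_sym12 4) (sym12_zero 4) (hb 4) ?_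
    rintro w ⟨h1, h2⟩
    change -w.1 = -n
    omega
  have g₃ : Good a (J {w | hnorm (w - (0, β)) ≤ n} (0, β)
      {v | v.1 = -n ∧ 2 * (v.2 - β) + n ≤ -β}) := by
    refine h.image ((isSymm_sym12 3).comp (isSymm_translate (0, β)))
      (by rw [sym12_zero, zero_add]) (fun w hw => ?_) ?_
    · simpa using hnorm_sym12 3 (mem_ball.1 hw)
    · rintro w ⟨h1, h2⟩
      change -w.1 + 0 = -n ∧ 2 * (-w.2 + β - β) + n ≤ -β
      omega
  have g₄ : Good a (J {w | hnorm (w - (0, β)) ≤ n} (0, β) {v | v.1 = n}) := by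
    refine h.image (isSymm_translate (0, β)) (zero_add _) (fun w hw => ?_) ?_
    · simpa using mem_ball.1 hw
    · rintro w ⟨h1, h2⟩
      simpa using h1
  have g := (g₁.inter g₂ ha ha).inter (g₃.inter g₄ ha ha) (by positivity) (by positivity)
  rw [show a * a * (a * a) = a ^ 4 by ring] at g
  refine g.mono (isUpperSet_J _ _ _) ?_
  rintro ω ⟨⟨⟨p₁, ⟨e₁, f₁⟩, h₁⟩, p₂, e₂, h₂⟩, ⟨p₃, ⟨e₃, f₃⟩, h₃⟩, p₄, e₄, h₄⟩
  exact ⟨_, rfl, link hn hβ h₁ e₁ f₁ h₂ e₂ h₃ e₃ f₃ h₄ e₄⟩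

end TriPerc

namespace TriPerc

open Function Relation Filter

/-- The rectangle containing the barrier. -/
def barrierRect (l : ℤ) : Set Site := {w | 4 * l ≤ w.1 ∧ w.1 ≤ 8 * l ∧ |w.2| ≤ 10 * l}

/-- The square `{|x|, |y| ≤ r}`. -/
def square (r : ℤ) : Set Site := {w | |w.1| ≤ r ∧ |w.2| ≤ r}

/-- An arm from `0` ending on the segment cut out by a barrier is joined to the barrier. -/
lemma hook {l : ℤ} (hl : 1 ≤ l) {O : Set Site} {y₀ v t b : Site}
    (hv : Conn (ball (8 * l) ∩ O) 0 v) (ev : v.1 = 8 * l)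
    (ht : Conn (barrierRect l ∩ O) y₀ t) (et : t.1 = 8 * l) (hvt : v.2 ≤ t.2)
    (hb : Conn (barrierRect l ∩ O) y₀ b) (eb : b.1 = 8 * l) (hbv : b.2 ≤ v.2) :
    Conn (square (10 * l) ∩ O) 0 y₀ := by
  have i₀ : ∀ w, Conn (ball (8 * l) ∩ O) 0 w →
      -(8 * l) ≤ w.1 ∧ w.1 ≤ 8 * l ∧ -(8 * l) ≤ w.2 ∧ w.2 ≤ 8 * l := by
    intro w hw
    have := hnorm_le_iff.1 (mem_ball.1 hw.right_mem.1)
    omega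
  have iy : ∀ w, Conn (barrierRect l ∩ O) y₀ w →
      4 * l ≤ w.1 ∧ w.1 ≤ 8 * l ∧ -(10 * l) ≤ w.2 ∧ w.2 ≤ 10 * l := fun w hw =>
    ⟨hw.right_mem.1.1, hw.right_mem.1.2.1, (abs_le.1 hw.right_mem.1.2.2).1,
      (abs_le.1 hw.right_mem.1.2.2).2⟩
  have glue : ∀ w, Conn (ball (8 * l) ∩ O) 0 w → Conn (barrierRect l ∩ O) y₀ w →
      Conn (square (10 * l) ∩ O) 0 y₀ := by
    intro w h h'
    refine (h.mono (Set.inter_subset_inter_left _ ?_)).trans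
      (h'.symm.mono (Set.inter_subset_inter_left _ ?_))
    · intro w hw
      have := hnorm_le_iff.1 (mem_ball.1 hw)
      exact ⟨abs_le.2 (by omega), abs_le.2 (by omega)⟩
    · rintro w ⟨h1, h2, h3⟩
      exact ⟨abs_le.2 (by omega), h3⟩
  obtain ⟨x₁, y₁⟩ := v
  obtain ⟨x₂, y₂⟩ := t
  obtain ⟨x₃, y₃⟩ := b
  simp only at ev et hvt eb hbv
  subst ev et eb
  have j₁ := i₀ _ hv
  have j₂ := iy _ ht
  have j₃ := iy _ hb
  simp only at j₁ j₂ j₃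
  by_cases ht' : y₂ = y₁
  · subst ht'
    exact glue _ hv ht
  by_cases hb' : y₃ = y₁
  · subst hb'
    exact glue _ hv hb
  set G : Set Site := {w | Conn (ball (8 * l) ∩ O) 0 w} ∪
    {w | w.2 = y₁ ∧ (w.1 = 8 * l + 1 ∨ w.1 = 8 * l + 2)} with hG
  set D : Set Site := {w | Conn (barrierRect l ∩ O) y₀ w} ∪
    {w | w.1 = 8 * l + 1 ∧ (w.2 ≤ y₃ ∨ y₂ ≤ w.2)} with hD
  have cG : Conn G 0 (8 * l + 2, y₁) := by
    have a₁ : Conn G 0 (8 * l, y₁) := hv.cluster.mono fun w hw => .inl hw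
    have a₂ := a₁.tail (w := (8 * l + 1, y₁)) (triAdj_iff.2 (by dsimp only; omega))
      (.inr ⟨rfl, .inl rfl⟩)
    exact a₂.tail (triAdj_iff.2 (by dsimp only; omega)) (.inr ⟨rfl, .inr rfl⟩)
  have cD : Conn D (8 * l + 1, 20 * l) (8 * l + 1, -(20 * l)) := by
    have s : {w | Conn (barrierRect l ∩ O) y₀ w} ⊆ D := fun w hw => .inl hw
    have a₁ : Conn D (8 * l + 1, y₂) (8 * l + 1, 20 * l) :=
      .vert (by omega) fun z hz _ => .inr ⟨rfl, .inr hz⟩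
    have a₂ : Conn D (8 * l + 1, -(20 * l)) (8 * l + 1, y₃) :=
      .vert (by omega) fun z _ hz => .inr ⟨rfl, .inl hz⟩
    have a₃ := a₁.symm.tail (w := (8 * l, y₂)) (triAdj_iff.2 (by dsimp only; omega)) (.inl ht)
    have a₄ := a₂.tail (w := (8 * l, y₃)) (triAdj_iff.2 (by dsimp only; omega)) (.inl hb)
    exact ((a₃.trans (ht.cluster.symm.mono s)).trans (hb.cluster.mono s)).trans a₄.symm
  obtain ⟨w, wG, wD⟩ := crossing (a := 4 * l) (b := 8 * l + 1) (c := -8 * l - 1) (d := 8 * l + 1)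
    cG cD (by dsimp only [Prod.fst_zero]; omega) (by dsimp only; omega)
    (by
      rintro w (hw | hw)
      · have := i₀ _ hw
        omega
      · have := hw.1
        omega)
    (by
      rintro w (hw | hw)
      · have := iy _ hw
        omega
      · have := hw.1
        omega)
    (by dsimp only; omega) (by dsimp only; omega)
  rcases wG with wG | wG <;> rcases wD with wD | wD
  · exact glue _ wG wD
  · have := i₀ _ wG
    have := wD.1
    omega
  · have := iy _ wD
    have := wG.2
    omega
  · have := wG.1
    have := wD.2
    omega

lemma good_hook {a : ℝ} {l β β' : ℤ} (ha : 0 ≤ a) (hl : 1 ≤ l) (hβ : 0 ≤ β) (hβl : β ≤ 2 * l)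
    (hββ' : β' ≤ 5 * β) (h : Good a (J (ball (2 * l)) 0 (sideHigh (2 * l) β)))
    (h' : Good a (J (ball (8 * l)) 0 (sideLow (8 * l) β'))) :
    Good (a ^ 19) (J (square (10 * l)) 0 {(6 * l, 3 * l)}) := by
  have hlink := good_link ha (by omega) hβ h
  have L : ∀ j : ℤ, -2 ≤ j → j ≤ 1 → Good (a ^ 4) (J (barrierRect l) (6 * l, 3 * l + j * β)
      {(6 * l, 3 * l + (j + 1) * β)}) := by
    intro j hj hj'
    have hjβ : -(2 * β) ≤ j * β ∧ j * β ≤ β := by constructor <;> nlinarith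
    refine hlink.image (isSymm_translate (6 * l, 3 * l + j * β)) (zero_add _) ?_ ?_
    · rintro w (hw | hw)
      · have := hnorm_le_iff.1 (mem_ball.1 hw)
        refine ⟨?_, ?_, abs_le.2 ?_⟩ <;> simp only [Prod.fst_add, Prod.snd_add] <;> omega
      · have := hnorm_le_iff.1 hw
        simp only [Prod.fst_sub, Prod.snd_sub] at this
        refine ⟨?_, ?_, abs_le.2 ?_⟩ <;> simp only [Prod.fst_add, Prod.snd_add] <;> omega
    · rintro w rfl
      refine Prod.ext ?_ ?_ <;> simp only [Prod.mk_add_mk] <;> ring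
  have hT : Good a (J (barrierRect l) (6 * l, 3 * l + 2 * β)
      {t | t.1 = 8 * l ∧ 8 * l + 5 * β ≤ 2 * t.2}) := by
    refine h.image (isSymm_translate (6 * l, 3 * l + 2 * β)) (zero_add _) ?_ ?_
    · intro w hw
      have := hnorm_le_iff.1 (mem_ball.1 hw)
      refine ⟨?_, ?_, abs_le.2 ?_⟩ <;> simp only [Prod.fst_add, Prod.snd_add] <;> omega
    · rintro w ⟨h1, h2⟩
      refine ⟨?_, ?_⟩ <;> simp only [Prod.fst_add, Prod.snd_add] <;> omega
  have hB : Good a (J (barrierRect l) (6 * l, 3 * l + -2 * β)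
      {t | t.1 = 8 * l ∧ 2 * t.2 ≤ 8 * l - 5 * β}) := by
    refine h.image ((isSymm_sym12 6).comp (isSymm_translate (6 * l, 3 * l + -2 * β)))
      (by rw [sym12_zero, zero_add]) ?_ ?_
    · intro w hw
      have := hnorm_le_iff.1 (hnorm_sym12 6 (mem_ball.1 hw))
      refine ⟨?_, ?_, abs_le.2 ?_⟩ <;> simp only [Prod.fst_add, Prod.snd_add] <;> omega
    · rintro w ⟨h1, h2⟩
      change w.1 + 6 * l = 8 * l ∧ 2 * (w.1 - w.2 + (3 * l + -2 * β)) ≤ 8 * l - 5 * β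
      omega
  have p : 0 ≤ a ^ 4 := by positivity
  have top := (((L 0 (by norm_num) (by norm_num)).trans (L 1 (by norm_num) (by norm_num)) p p
    subset_rfl subset_rfl).trans hT (by positivity) ha subset_rfl subset_rfl)
  have bot := (L (-2) (by norm_num) (by norm_num)).trans (L (-1) (by norm_num) (by norm_num)) p p
    subset_rfl subset_rfl
  have g := (h'.inter top ha (by positivity)).inter (bot.inter hB (by positivity) ha)
    (by positivity) (by positivity)
  rw [show a * (a ^ 4 * a ^ 4 * a) * (a ^ 4 * a ^ 4 * a) = a ^ 19 by ring] at g
  refine g.mono (isUpperSet_J _ _ _) ?_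
  rintro ω ⟨⟨⟨v, ⟨v1, v2, v3⟩, hv⟩, t, ⟨t1, t2⟩, ht⟩, ⟨_, rfl, hy⟩, b, ⟨b1, b2⟩, hb⟩
  rw [show 3 * l + 0 * β = 3 * l by ring] at ht
  rw [show 3 * l + (-1 + 1) * β = 3 * l by ring] at hy
  exact ⟨_, rfl, hook hl hv v1 ht t1 (by omega) (hy.symm.trans hb) b1 (by omega)⟩

/-- Since the heights grow at most linearly, there are arbitrarily large scales at which they do
not grow too fast. -/
lemma exists_scale {β : ℤ → ℤ} (h0 : ∀ n, 0 ≤ n → 0 ≤ β n) (h1 : ∀ n, 0 ≤ n → β n ≤ n)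
    {M : ℤ} (hM : 0 ≤ M) : ∃ l, M < l ∧ β (8 * l) ≤ 5 * β (2 * l) := by
  by_contra hc
  push Not at hc
  have hp : ∀ j : ℕ, M + 1 ≤ (M + 1) * 4 ^ j := fun j =>
    le_mul_of_one_le_right (by omega) (one_le_pow₀ (by norm_num))
  have hstep : ∀ j : ℕ, 5 ^ j ≤ β (2 * ((M + 1) * 4 ^ (j + 1))) := by
    intro j
    have e : ∀ j : ℕ, 2 * ((M + 1) * 4 ^ (j + 1)) = 8 * ((M + 1) * 4 ^ j) := fun j => by ring
    induction j with
    | zero =>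
      have := hc ((M + 1) * 4 ^ 0) (by have := hp 0; omega)
      rw [e]
      have := h0 (2 * ((M + 1) * 4 ^ 0)) (by have := hp 0; omega)
      simp only [pow_zero] at *
      omega
    | succ j ih =>
      have := hc ((M + 1) * 4 ^ (j + 1)) (by have := hp (j + 1); omega)
      rw [e, pow_succ]
      omega
  obtain ⟨j, hj⟩ := pow_unbounded_of_one_lt (8 * (M + 1) : ℝ) (show (1 : ℝ) < 5 / 4 by norm_num)
  have h2 := (hstep j).trans (h1 _ (by have := hp (j + 1); omega))
  have h3 : (5 : ℝ) ^ j ≤ 2 * ((M + 1) * 4 ^ (j + 1)) := by exact_mod_cast h2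
  rw [div_pow, lt_div_iff₀ (by positivity)] at hj
  rw [pow_succ] at h3
  linarith

end TriPerc

namespace TriPerc

open Function Relation Filter

/-! ### Circuits and the absence of percolation at `1 / 2` -/

/-- The maximum norm. -/
def mx (w : Site) : ℤ := max |w.1| |w.2|

lemma mx_le_iff {w : Site} {n : ℤ} : mx w ≤ n ↔ -n ≤ w.1 ∧ w.1 ≤ n ∧ -n ≤ w.2 ∧ w.2 ≤ n := by
  rw [mx, max_le_iff, abs_le, abs_le]
  tauto

lemma mx_adj {a b : Site} (h : triAdj a b) : mx b ≤ mx a + 1 := by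
  have h1 := mx_le_iff.1 (le_refl (mx a))
  rw [triAdj_iff] at h
  rw [mx_le_iff]
  omega

/-- The four symmetries mapping the right side of a square to its four sides. -/
def quarter : Finset (Fin 12) := {0, 3, 8, 11}

/-- The vertical strip on the right containing a vertical chain. -/
def strip (l : ℤ) : Set Site := {w | l ≤ w.1 ∧ w.1 ≤ 47 * l ∧ |w.2| ≤ 100 * l}

/-- The event that there is a chain along one of the four sides. -/
def sideChain (l : ℤ) (i : Fin 12) : Set Config :=
  J {w | sym12inv i w ∈ strip l} (sym12 i (24 * l, -54 * l)) {sym12 i (24 * l, 54 * l)}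

/-- The event that there are chains along all four sides. -/
def block (l : ℤ) : Set Config := {ω | ∀ i ∈ quarter, ω ∈ sideChain l i}

lemma quarter_sym {i : Fin 12} (hi : i ∈ quarter) (w : Site) :
    sym12inv i w = (w.1, w.2) ∨ sym12inv i w = (-w.1, -w.2) ∨ sym12inv i w = (-w.2, -w.1) ∨
      sym12inv i w = (w.2, w.1) := by
  simp only [quarter, Finset.mem_insert, Finset.mem_singleton] at hi
  rcases hi with rfl | rfl | rfl | rfl
  · exact .inl rfl
  · exact .inr (.inl rfl)
  · exact .inr (.inr (.inl rfl))
  · exact .inr (.inr (.inr rfl))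

lemma dependsOn_block (l : ℤ) :
    DependsOn (· ∈ block l) {w | l ≤ mx w ∧ mx w ≤ 100 * l} := by
  have h : ∀ i ∈ quarter, DependsOn (· ∈ sideChain l i) {w | l ≤ mx w ∧ mx w ≤ 100 * l} := by
    intro i hi
    refine DependsOn.mono' (dependsOn_J _ _ _) ?_
    rintro w ⟨h1, h2, h3⟩
    rw [abs_le] at h3
    have h4 := mx_le_iff.1 (le_refl (mx w))
    constructor
    · rcases quarter_sym hi w with h | h | h | h <;> rw [h] at h1 <;> dsimp only at h1 <;> omega
    · rw [mx_le_iff]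
      rcases quarter_sym hi w with h | h | h | h <;> rw [h] at h1 h2 h3 <;>
        dsimp only at h1 h2 h3 <;> omega
  intro ω ω' hω
  simp only [block, Set.mem_ofPred_eq]
  exact propext (forall₂_congr fun i hi => Iff.of_eq (h i hi hω))

/-- A path avoiding the chains cannot leave the block. -/
lemma mx_lt_of_block {l : ℤ} (hl : 1 ≤ l) {ω : Config} (hω : ω ∈ block l) {v : Site}
    (hv : Conn (openSites ω)ᶜ 0 v) : mx v < 48 * l := by
  by_contra hc
  push Not at hc
  obtain ⟨y, hy, h⟩ := hv.hit (f := mx) (fun a b => mx_adj) (m := 48 * l)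
    (mx_le_iff.2 (by dsimp only [Prod.fst_zero, Prod.snd_zero]; omega)) hc
  have hy1 := mx_le_iff.1 hy.le
  have hy2 : ¬ mx y ≤ 48 * l - 1 := by omega
  rw [mx_le_iff] at hy2
  obtain ⟨i, hi, hyi⟩ : ∃ i ∈ quarter, (sym12inv i y).1 = 48 * l := by
    have : y.1 = 48 * l ∨ -y.1 = 48 * l ∨ -y.2 = 48 * l ∨ y.2 = 48 * l := by omega
    rcases this with h | h | h | h
    · exact ⟨0, by decide, h⟩
    · exact ⟨3, by decide, h⟩
    · exact ⟨8, by decide, h⟩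
    · exact ⟨11, by decide, h⟩
  have hs := isSymm_sym12 i
  have hinv : ∀ a b, triAdj a b → triAdj (sym12inv i a) (sym12inv i b) := by
    intro a b hab
    rw [triAdj_iff] at hab ⊢
    simp only [quarter, Finset.mem_insert, Finset.mem_singleton] at hi
    rcases hi with rfl | rfl | rfl | rfl <;>
      simp only [sym12inv, Matrix.cons_val_zero, Matrix.cons_val] <;> omega
  have h0 : sym12inv i 0 = 0 := by
    have := hs.left 0
    rwa [sym12_zero] at this
  have cG : Conn {w | sym12 i w ∉ openSites ω ∧ |w.2| ≤ 48 * l} (sym12inv i 0)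
      (sym12inv i y) := by
    refine h.map hinv fun w hw => ⟨?_, ?_⟩
    · rw [hs.right]
      exact hw.1
    · have h1 := mx_le_iff.1 hw.2
      rw [abs_le]
      rcases quarter_sym hi w with h | h | h | h <;> rw [h] <;> dsimp only <;> omega
  obtain ⟨_, rfl, hD⟩ := hω i hi
  have cD := hD.symm.map (S' := {w | sym12 i w ∈ openSites ω ∧ w ∈ strip l}) hinv fun w hw =>
    ⟨by rw [hs.right]; exact hw.2, hw.1⟩
  rw [hs.left, hs.left] at cD
  rw [h0] at cG
  obtain ⟨w, w1, w2⟩ := crossing (a := l) (b := 47 * l) (c := -54 * l) (d := 54 * l) cG cD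
    (by dsimp only [Prod.fst_zero]; omega) (by omega)
    (fun w hw => by have := abs_le.1 hw.2; omega) (fun w hw => ⟨hw.2.1, hw.2.2.1⟩) le_rfl le_rfl
  exact w1.1 w2.1

lemma good_block {c : ℝ} {l : ℤ} (hc : 0 < c) (hl : 1 ≤ l)
    (h : Good c (J (square (10 * l)) 0 {(6 * l, 3 * l)})) :
    Good (((c * c) ^ 12) ^ 4) (block l) := by
  have h₁ : Good c (J (square (10 * l)) 0 {(3 * l, 6 * l)}) := by
    refine h.image (isSymm_sym12 11) (sym12_zero 11) ?_ ?_
    · rintro w ⟨h1, h2⟩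
      exact ⟨h2, h1⟩
    · rintro w rfl
      rfl
  have h₂ : Good c (J {w | |w.1| ≤ 23 * l ∧ |w.2| ≤ 26 * l} (3 * l, 6 * l) {(0, 9 * l)}) := by
    refine h.image ((isSymm_sym12 2).comp (isSymm_translate (3 * l, 6 * l)))
      (by rw [sym12_zero, zero_add]) ?_ ?_
    · rintro w ⟨h1, h2⟩
      rw [abs_le] at h1 h2
      change |-w.2 + 3 * l| ≤ _ ∧ |w.1 - w.2 + 6 * l| ≤ _
      rw [abs_le, abs_le]
      omega
    · rintro w rfl
      change (-(3 * l) + 3 * l, 6 * l - 3 * l + 6 * l) = (0, 9 * l)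
      refine Prod.ext ?_ ?_ <;> dsimp only <;> ring
  have h₃ : Good (c * c) (J {w | |w.1| ≤ 23 * l ∧ |w.2| ≤ 26 * l} 0 {(0, 9 * l)}) := by
    refine h₁.trans h₂ hc.le hc.le ?_ subset_rfl
    rintro w ⟨h1, h2⟩
    exact ⟨by omega, by omega⟩
  have hop : ∀ k : ℕ, k ≤ 11 → Good ((c * c) ^ (k + 1)) (J (strip l) (24 * l, -54 * l)
      {(24 * l, -54 * l + 9 * l * (k + 1))}) := by
    have hh : ∀ k : ℕ, k ≤ 11 → Good (c * c) (J (strip l) (24 * l, -54 * l + 9 * l * k)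
        {(24 * l, -54 * l + 9 * l * (k + 1))}) := by
      intro k hk
      have hk1 : 0 ≤ 9 * l * k := by positivity
      have hk2 : 9 * l * k ≤ 9 * l * 11 := by
        have : (k : ℤ) ≤ 11 := by exact_mod_cast hk
        exact mul_le_mul_of_nonneg_left this (by omega)
      refine h₃.image (isSymm_translate (24 * l, -54 * l + 9 * l * k)) (zero_add _) ?_ ?_
      · rintro w ⟨h1, h2⟩
        rw [abs_le] at h1 h2
        refine ⟨?_, ?_, abs_le.2 ?_⟩ <;> simp only [Prod.fst_add, Prod.snd_add] <;> omega
      · rintro w rfl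
        refine Prod.ext ?_ ?_ <;> simp only [Prod.mk_add_mk] <;> ring
    intro k
    induction k with
    | zero =>
      intro _
      simpa using hh 0 (by norm_num)
    | succ k ih =>
      intro hk
      have := (ih (by omega)).trans (by simpa using hh (k + 1) hk) (by positivity)
        (by positivity) subset_rfl subset_rfl
      rw [pow_succ]
      simpa using this
  have hs := hop 11 le_rfl
  have hi : ∀ i, Good ((c * c) ^ 12) (sideChain l i) := by
    intro i
    refine hs.image (isSymm_sym12 i) rfl (fun w hw => ?_) ?_
    · change sym12inv i (sym12 i w) ∈ strip l
      rwa [(isSymm_sym12 i).left]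
    · rintro w rfl
      have : -54 * l + 9 * l * ((11 : ℕ) + 1) = 54 * l := by push_cast; ring
      rw [this]
      rfl
  have p : 0 ≤ (c * c) ^ 12 := by positivity
  have g := ((hi 0).inter (hi 3) p p).inter ((hi 8).inter (hi 11) p p) (by positivity)
    (by positivity)
  rw [show ∀ x : ℝ, x * x * (x * x) = x ^ 4 from fun x => by ring] at g
  refine g.mono (fun ω ω' hle hω i hi => isUpperSet_J _ _ _ hle (hω i hi)) ?_
  rintro ω ⟨⟨g0, g3⟩, g8, g11⟩ i hi
  simp only [quarter, Finset.mem_insert, Finset.mem_singleton] at hi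
  rcases hi with rfl | rfl | rfl | rfl <;> assumption

/-- Independent blocks at many scales make long closed paths unlikely. -/
lemma exists_unlikely {c : ℝ} (hc : ∀ M : ℤ, 0 ≤ M → ∃ l, M < l ∧ Good c (block l)) (I : ℕ) :
    ∃ M : ℤ, 1 ≤ M ∧ ∃ E : Set Config, DependsOn (· ∈ E) {w | mx w ≤ M} ∧
      (∀ ω v, Conn (openSites ω)ᶜ 0 v → M ≤ mx v → ω ∈ E) ∧
      ∀ᶠ Λ : Finset Site in atTop, Pr (1 / 2) Λ E ≤ (1 - c) ^ I := by
  induction I with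
  | zero =>
    exact ⟨1, le_rfl, Set.univ, fun _ _ _ => rfl, fun _ _ _ _ => trivial, .of_forall fun Λ => by
      rw [Pr_univ, pow_zero]⟩
  | succ I ih =>
    obtain ⟨M, hM, E, hE, hpath, hP⟩ := ih
    obtain ⟨l, hl, hg⟩ := hc M (by omega)
    have hb : DependsOn (· ∈ (block l)ᶜ) {w | l ≤ mx w ∧ mx w ≤ 100 * l} := fun ω ω' h => by
      have := dependsOn_block l h
      simp only [Set.mem_compl_iff] at this ⊢
      rw [this]
    refine ⟨100 * l, by omega, E ∩ (block l)ᶜ, ?_, ?_, ?_⟩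
    · intro ω ω' h
      have h1 : (ω ∈ E) = (ω' ∈ E) := hE fun w hw => h w (by
        simp only [Set.mem_ofPred_eq] at hw ⊢; omega)
      have h2 : (ω ∈ (block l)ᶜ) = (ω' ∈ (block l)ᶜ) := hb fun w hw => h w hw.2
      simp only [Set.mem_inter_iff, h1, h2]
    · intro ω v hv hm
      refine ⟨hpath ω v hv (by omega), fun hω => ?_⟩
      have := mx_lt_of_block (by omega) hω hv
      omega
    · filter_upwards [hP, hg.2] with Λ h1 h2
      rw [Pr_inter_of_disjoint _ Λ hE hb (Set.disjoint_left.2 fun w h3 h4 => by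
        simp only [Set.mem_ofPred_eq] at h3 h4; omega), Pr_compl, pow_succ]
      have := Pr_le_one half_nonneg half_le_one Λ (block l)
      exact mul_le_mul h1 (by linarith) (by linarith)
        ((Pr_nonneg half_nonneg half_le_one Λ E).trans h1)

/-- There is no percolation at `1 / 2`. -/
theorem exists_theta_lt {c : ℝ} (hc : 0 < c) : ∃ n : ℤ, 0 ≤ n ∧ theta (1 / 2) n < c := by
  by_contra hcon
  push Not at hcon
  have hβ := fun n : ℤ => fun hn : 0 ≤ n => exists_height hc n hn (hcon n hn)
  choose! β b0 b1 hH hL using hβ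
  set d : ℝ := ((((c / 24) ^ 19 * (c / 24) ^ 19) ^ 12) ^ 4) with hd
  have hd0 : 0 < d := by positivity
  have hblock : ∀ M : ℤ, 0 ≤ M → ∃ l, M < l ∧ Good d (block l) := by
    intro M hM
    obtain ⟨l, hl, hs⟩ := exists_scale b0 b1 hM
    refine ⟨l, hl, good_block (by positivity) (by omega) ?_⟩
    exact good_hook (by positivity) (by omega) (b0 _ (by omega)) (b1 _ (by omega)) hs
      (hH _ (by omega)) (hL _ (by omega))
  have hd1 : d ≤ 1 := by
    obtain ⟨l, -, hg⟩ := hblock 0 le_rfl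
    obtain ⟨Λ, hΛ⟩ := hg.2.exists
    exact hΛ.trans (Pr_le_one half_nonneg half_le_one Λ _)
  obtain ⟨I, hI⟩ := exists_pow_lt_of_lt_one hc (show 1 - d < 1 by linarith)
  obtain ⟨M, hM, E, -, hpath, hP⟩ := exists_unlikely hblock I
  obtain ⟨Λ, h1, h2⟩ := (hP.and (eventually_ge_atTop (ball (2 * M)))).exists
  have h3 := hcon (2 * M) (by omega)
  rw [theta, ← Pr_congr_of_subset _ h2 (dependsOn_arm _)] at h3
  have h4 := Pr_flip (1 / 2) Λ (A := arm (2 * M))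
    (DependsOn.mono' (dependsOn_arm _) h2)
  rw [show (1 : ℝ) - 1 / 2 = 1 / 2 by norm_num] at h4
  rw [← h4] at h3
  have h5 : Pr (1 / 2) Λ {ω | (fun v => !ω v) ∈ arm (2 * M)} ≤ Pr (1 / 2) Λ E := by
    refine Pr_mono half_nonneg half_le_one Λ ?_
    rintro ω ⟨v, hv, hω⟩
    refine hpath ω v (hω.mono fun w hw => ?_) ?_
    · have := hw.2
      simp only [openSites, Set.mem_ofPred_eq, Set.mem_compl_iff] at this ⊢
      simpa using this
    · by_contra hlt
      have hm := mx_le_iff.1 (show mx v ≤ M - 1 by omega)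
      have hv' : ¬ hnorm v ≤ 2 * M - 1 := by omega
      rw [hnorm_le_iff] at hv'
      omega
  linarith

end TriPerc

namespace TriPerc

open Function Relation

/-! ### Exponential decay and sprinkling -/

/-- Exponential decay of arms in the subcritical regime. -/
theorem exists_exp_decay {s : ℝ} (hs : 0 ≤ s) (hs' : s < 1 / 2) :
    ∃ C > (0 : ℝ), ∃ c > (0 : ℝ), ∀ n : ℕ, theta s n ≤ C * Real.exp (-c * n) := by
  obtain ⟨S, h0, hS⟩ : ∃ S : Finset Site, (0 : Site) ∈ S ∧ psi s S < 1 := by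
    by_contra hc
    push Not at hc
    have hd : 0 < (1 / 2 - s) / (1 + (1 / 2 - s)) := div_pos (by linarith) (by linarith)
    obtain ⟨n, hn, hlt⟩ := exists_theta_lt hd
    exact (theta_lower_bound hs hs' (by norm_num) hc hn).not_gt hlt
  obtain ⟨w, hw, hmax⟩ := S.exists_max_image hnorm ⟨0, h0⟩
  have hL : S ⊆ ball (hnorm w) := fun v hv => mem_ball.2 (hmax v hv)
  have hL0 : 0 ≤ hnorm w := hnorm_nonneg w
  obtain ⟨L, hLL⟩ := Int.eq_ofNat_of_zero_le hL0
  set x : ℝ := max (psi s S) (1 / 2) with hx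
  have hx0 : 0 < x := lt_max_of_lt_right (by norm_num)
  have hx1 : x < 1 := max_lt hS (by norm_num)
  have hlog : Real.log x < 0 := Real.log_neg hx0 hx1
  have hLp : (0 : ℝ) < L + 1 := by positivity
  refine ⟨Real.exp (-Real.log x), Real.exp_pos _, -Real.log x / (L + 1),
    div_pos (by linarith) hLp, fun n => ?_⟩
  have h1 : theta s n ≤ psi s S ^ (n / (L + 1)) := by
    refine theta_le_pow hs (by linarith) hL hL0 h0 _ ?_
    rw [hLL]
    exact_mod_cast Nat.div_mul_le_self n (L + 1)
  have h2 : psi s S ^ (n / (L + 1)) ≤ x ^ (n / (L + 1)) :=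
    pow_le_pow_left₀ (psi_nonneg hs (by linarith) S) (le_max_left _ _) _
  refine (h1.trans h2).trans ?_
  rw [← Real.exp_log (pow_pos hx0 _), Real.log_pow, ← Real.exp_add, Real.exp_le_exp]
  have h3 : (n : ℝ) / (L + 1) ≤ (n / (L + 1) : ℕ) + 1 := by
    rw [div_le_iff₀ hLp]
    have := Nat.lt_div_mul_add (a := n) (b := L + 1) (by omega)
    have h4 : n ≤ (n / (L + 1) + 1) * (L + 1) := by rw [add_mul, one_mul]; exact this.le
    exact_mod_cast h4
  have h5 : -(-Real.log x / (L + 1)) * n = (n / (L + 1)) * Real.log x := by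
    field_simp
  rw [h5]
  nlinarith

/-- The sites of the box. -/
noncomputable def boxSites (n : ℕ) : Finset Site := Finset.Icc 0 (n : ℤ) ×ˢ Finset.Icc 0 (n : ℤ)

lemma mem_boxSites {n : ℕ} {v : Site} : v ∈ boxSites n ↔ v ∈ box n := by
  simp only [boxSites, Finset.mem_product, Finset.mem_Icc, box, Set.mem_ofPred_eq]
  tauto

/-- The box has a vertical crossing after opening at most `r` sites. -/
def nearCross (n r : ℕ) : Set Config :=
  {ω | ∃ T : Finset Site, T.card ≤ r ∧ ∃ u v : Site, u.2 = 0 ∧ v.2 = n ∧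
    Conn (box n ∩ (openSites ω ∪ T)) u v}

lemma dependsOn_nearCross (n r : ℕ) : DependsOn (· ∈ nearCross n r) (boxSites n : Set Site) := by
  have h := dependsOn_of_openSites (box n) fun X => ∃ T : Finset Site, T.card ≤ r ∧
    ∃ u v : Site, u.2 = 0 ∧ v.2 = n ∧ Conn (X ∪ (box n ∩ T)) u v
  simp only [← Set.inter_union_distrib_left] at h
  exact DependsOn.mono' h fun v hv => mem_boxSites.2 hv

lemma pow_card_le_Pr {k : ℝ} (hk : 0 ≤ k) (hk1 : k ≤ 1) {Λ T : Finset Site} (hT : T ⊆ Λ) :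
    k ^ T.card ≤ Pr k Λ {η | ∀ v ∈ T, η v = true} := by
  have hd : DependsOn (· ∈ {η : Config | ∀ v ∈ T, η v = true}) (T : Set Site) := fun ω ω' h =>
    propext (forall₂_congr fun v hv => by rw [h v hv])
  rw [Pr_congr_of_subset k hT hd]
  have h1 : (∏ v ∈ T, if v ∈ T then k else 1 - k) *
      ({η : Config | ∀ v ∈ T, η v = true}.indicator (fun _ => 1) (cfg T)) = k ^ T.card := by
    rw [Set.indicator_of_mem (by intro v hv; simpa [cfg] using hv), mul_one,
      Finset.prod_congr rfl fun v hv => if_pos hv, Finset.prod_const]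
  rw [← h1]
  refine Finset.single_le_sum (f := fun B => (∏ v ∈ T, if v ∈ B then k else 1 - k) *
    ({η : Config | ∀ v ∈ T, η v = true}.indicator (fun _ => 1) (cfg B))) (fun B _ => ?_)
    (Finset.mem_powerset_self T)
  refine mul_nonneg (Finset.prod_nonneg fun v _ => ?_)
    (Set.indicator_nonneg (fun _ _ => zero_le_one) _)
  split_ifs <;> linarith

lemma Ex_const_mul (p : ℝ) (Λ : Finset Site) (c : ℝ) (f : Config → ℝ) :
    Ex p Λ (fun ω => c * f ω) = c * Ex p Λ f := by
  simp only [Ex, Finset.mul_sum]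
  exact Finset.sum_congr rfl fun B _ => by ring

/-- Sprinkling turns a near crossing into a crossing. -/
lemma sprinkle_nearCross {s k : ℝ} (hs : 0 ≤ s) (hs1 : s ≤ 1) (hk : 0 ≤ k) (hk1 : k ≤ 1)
    (n r : ℕ) : k ^ r * Pr s (boxSites n) (nearCross n r) ≤
      Pr (s + (1 - s) * k) (boxSites n) (nearCross n 0) := by
  classical
  rw [Pr, Pr, Ex_sprinkle, ← Ex_const_mul]
  refine Ex_mono hs hs1 _ fun ω => ?_
  by_cases hω : ω ∈ nearCross n r
  · rw [Set.indicator_of_mem hω, mul_one]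
    obtain ⟨T, hT, u, v, hu, hv, h⟩ := hω
    have h1 : k ^ r ≤ k ^ (T ∩ boxSites n).card := pow_le_pow_of_le_one hk hk1
      ((Finset.card_le_card Finset.inter_subset_left).trans hT)
    refine (h1.trans (pow_card_le_Pr hk hk1 Finset.inter_subset_right)).trans ?_
    refine Ex_mono hk hk1 _ fun η => ?_
    by_cases hη : η ∈ {η : Config | ∀ v ∈ T ∩ boxSites n, η v = true}
    · rw [Set.indicator_of_mem hη, Set.indicator_of_mem]
      refine ⟨∅, le_rfl, u, v, hu, hv, h.mono ?_⟩
      rintro w ⟨hw, hw' | hw'⟩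
      · refine ⟨hw, .inl ?_⟩
        change (ω w || η w) = true
        rw [show ω w = true from hw', Bool.true_or]
      · refine ⟨hw, .inl ?_⟩
        change (ω w || η w) = true
        rw [hη w (Finset.mem_inter.2 ⟨hw', mem_boxSites.2 hw⟩), Bool.or_true]
    · rw [Set.indicator_of_notMem hη]
      exact Set.indicator_nonneg (fun _ _ => zero_le_one) _
  · rw [Set.indicator_of_notMem hω, mul_zero]
    exact Ex_nonneg hk hk1 _ fun η => Set.indicator_nonneg (fun _ _ => zero_le_one) _

lemma Pr_cross_le {s : ℝ} (hs : 0 ≤ s) (hs1 : s ≤ 1) (n : ℕ) :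
    Pr s (boxSites n) (nearCross n 0) ≤ (n + 1) * theta s n := by
  set Λ : Finset Site := Finset.Icc (-(2 * n) : ℤ) (2 * n) ×ˢ Finset.Icc (-(2 * n) : ℤ) (2 * n)
  have hΛ : boxSites n ⊆ Λ := by
    intro w hw
    simp only [boxSites, Λ, Finset.mem_product, Finset.mem_Icc] at hw ⊢
    omega
  rw [← Pr_congr_of_subset s hΛ (dependsOn_nearCross n 0)]
  refine (Pr_biUnion_le hs hs1 Λ (Finset.range (n + 1)) _
    (fun i => {ω | ω ∘ Equiv.addRight ((i : ℤ), (0 : ℤ)) ∈ arm n}) ?_).trans_eq ?_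
  · rintro ω ⟨T, hT, u, v, hu, hv, h⟩
    obtain rfl : T = ∅ := by simpa using hT
    rw [Finset.coe_empty, Set.union_empty] at h
    obtain ⟨h1, h2, -⟩ := h.left_mem.1
    obtain ⟨i, hi⟩ := Int.eq_ofNat_of_zero_le h1
    have hu' : u = ((i : ℤ), (0 : ℤ)) := Prod.ext hi hu
    refine ⟨i, Finset.mem_range.2 (by omega), ?_⟩
    rw [← hu']
    refine mem_arm_of_conn (by positivity) h ?_
    by_contra hlt
    have := hnorm_le_iff.1 (show hnorm (v - u) ≤ n - 1 by omega)
    simp only [Prod.fst_sub, Prod.snd_sub] at this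
    omega
  · rw [Finset.sum_congr rfl fun i hi => Pr_translate_arm s (M := n) ?_]
    · simp [theta]
    · intro w hw
      have := hnorm_le_iff.1 hw
      rw [Finset.mem_range] at hi
      simp only [Prod.fst_sub, Prod.snd_sub] at this
      simp only [Λ, Finset.mem_product, Finset.mem_Icc]
      omega

/-- The probability of a local event, computed in a finite volume. -/
lemma measure_le_Pr {p : ℝ} (hp : 0 ≤ p) (hp1 : p ≤ 1) {μ : Measure Config}
    (hμ : IsBernoulliPercolation p μ) {Λ : Finset Site} {A : Set Config}
    (hA : DependsOn (· ∈ A) (Λ : Set Site)) : μ A ≤ ENNReal.ofReal (Pr p Λ A) := by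
  classical
  have hsub : A ⊆ ⋃ B ∈ Λ.powerset.filter fun B => cfg B ∈ A, {ω | ∀ v ∈ Λ, ω v = cfg B v} := by
    intro ω hω
    have hω' : ∀ v ∈ Λ, ω v = cfg (Λ.filter fun v => ω v = true) v := by
      intro v hv
      simp [cfg, hv]
    simp only [Set.mem_iUnion, Finset.mem_filter, Finset.mem_powerset]
    exact ⟨_, ⟨Finset.filter_subset _ _, (hA hω').mp hω⟩, hω'⟩
  refine ((measure_mono hsub).trans (measure_biUnion_finset_le _ _)).trans ?_
  rw [Pr, Ex, ENNReal.ofReal_sum_of_nonneg, Finset.sum_filter]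
  · refine Finset.sum_le_sum fun B _ => ?_
    split_ifs with hB
    · rw [hμ.2, Set.indicator_of_mem hB, mul_one, ENNReal.ofReal_prod_of_nonneg]
      · refine (Finset.prod_congr rfl fun v _ => ?_).le
        by_cases hv : v ∈ B <;> simp [cfg, hv]
      · intro v _
        split_ifs <;> linarith
    · exact zero_le
  · intro B _
    refine mul_nonneg (Finset.prod_nonneg fun v _ => ?_)
      (Set.indicator_nonneg (fun _ _ => zero_le_one) _)
    split_ifs <;> linarith

lemma measure_few_crossings_le {p : ℝ} (hp : 0 ≤ p) (hp1 : p ≤ 1) {μ : Measure Config}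
    (hμ : IsBernoulliPercolation p μ) (n : ℕ) (C : ℝ) :
    μ {ω | ∀ k : ℕ, HasDisjointCrossings n ω k → (k : ℝ) ≤ C * n} ≤
      ENNReal.ofReal (Pr (1 - p) (boxSites n) (nearCross n ⌊C * n⌋₊)) := by
  rw [← Pr_flip p _ (dependsOn_nearCross _ _)]
  have hd : DependsOn (· ∈ {ω : Config | (fun v => !ω v) ∈ nearCross n ⌊C * n⌋₊})
      (boxSites n : Set Site) := fun ω ω' h =>
    dependsOn_nearCross n ⌊C * n⌋₊ (x := fun v => !ω v) (y := fun v => !ω' v)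
      fun v hv => by simp only [h v hv]
  refine (measure_mono ?_).trans (measure_le_Pr hp hp1 hμ hd)
  intro ω hω
  rcases disjointCrossings_or n ⌊C * n⌋₊ ω with h | ⟨T, hT, u, v, hu, hv, h⟩
  · have h1 := hω _ h
    have h2 := Nat.lt_floor_add_one (C * (n : ℝ))
    push_cast at h1
    linarith
  · refine ⟨T, hT, u, v, hu, hv, h.mono ?_⟩
    rintro w ⟨hw, hw' | hw'⟩
    · refine ⟨hw, .inl ?_⟩
      simpa [openSites] using hw'
    · exact ⟨hw, .inr hw'⟩

end TriPerc

/-- Theorem 4, inequality (21): for supercritical `p > 1/2`, the maximal number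
`M_n` of pairwise vertex-disjoint open left–right crossings of `[0, n]²`
satisfies `P_p(M_n ≤ C₅ n) ≤ e^{−C₆ n}` for all `n ≥ N₁(p)`. -/
theorem many_disjoint_crossings (p : ℝ) (hp1 : 1 / 2 < p) (hp2 : p ≤ 1) :
    ∃ C₅ > (0 : ℝ), ∃ C₆ > (0 : ℝ), ∃ N₁ : ℕ, ∀ n : ℕ, N₁ ≤ n →
      ∀ μ : Measure Config, IsBernoulliPercolation p μ →
        μ {ω | ∀ k : ℕ, HasDisjointCrossings n ω k → (k : ℝ) ≤ C₅ * n} ≤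
          ENNReal.ofReal (Real.exp (-C₆ * n)) := by
  set s := 1 - p with hs
  set s' := (s + 1 / 2) / 2 with hs'
  set k := (s' - s) / (1 - s) with hk
  have hs0 : 0 ≤ s := by linarith
  have hs1 : 0 < 1 - s := by linarith
  have hss : s' < 1 / 2 := by linarith
  have hs's : s < s' := by linarith
  have hk0 : 0 < k := div_pos (by linarith) hs1
  have hk1 : k < 1 := by rw [hk, div_lt_one hs1]; linarith
  have hks : s + (1 - s) * k = s' := by rw [hk]; field_simp; ring
  obtain ⟨C, hC, c, hc, hdecay⟩ := TriPerc.exists_exp_decay (s := s') (by linarith) hss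
  have hlog : Real.log k < 0 := Real.log_neg hk0 hk1
  refine ⟨c / (4 * -Real.log k), div_pos hc (by linarith), c / 2, by linarith,
    ⌈64 * C / c ^ 2⌉₊ + 1, fun n hn μ hμ => ?_⟩
  set C₅ := c / (4 * -Real.log k) with hC₅
  have hC₅0 : 0 < C₅ := div_pos hc (by linarith)
  refine (TriPerc.measure_few_crossings_le (by linarith) hp2 hμ n C₅).trans
    (ENNReal.ofReal_le_ofReal ?_)
  have h1 := TriPerc.sprinkle_nearCross hs0 (by linarith) hk0.le hk1.le n ⌊C₅ * n⌋₊
  rw [hks] at h1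
  have h2 := h1.trans (TriPerc.Pr_cross_le (by linarith) (by linarith) n)
  have h3 : Real.exp (-(c / 4 * n)) ≤ k ^ ⌊C₅ * n⌋₊ := by
    rw [← Real.exp_log (pow_pos hk0 _), Real.exp_le_exp, Real.log_pow]
    have h4 := Nat.floor_le (show 0 ≤ C₅ * (n : ℝ) by positivity)
    have h5 : c / 4 * n = (C₅ * n) * -Real.log k := by
      rw [hC₅]
      have : Real.log k ≠ 0 := hlog.ne
      field_simp
    rw [h5]
    nlinarith
  have h6 : (n + 1) * C ≤ Real.exp (c / 4 * n) := by
    have h7 : 64 * C / c ^ 2 ≤ n :=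
      (Nat.le_ceil _).trans (by exact_mod_cast (Nat.le_succ _).trans hn)
    have h8 : (1 : ℝ) ≤ n := by exact_mod_cast (Nat.le_add_left 1 _).trans hn
    have h9 := Real.quadratic_le_exp_of_nonneg (show 0 ≤ c / 4 * n by positivity)
    rw [div_le_iff₀ (by positivity)] at h7
    have h10 : 64 * C * n ≤ n * c ^ 2 * n := mul_le_mul_of_nonneg_right h7 (by positivity)
    have h11 : 0 ≤ c / 4 * n := by positivity
    nlinarith
  have h12 : Real.exp (-(c / 4 * n)) *
      TriPerc.Pr s (TriPerc.boxSites n) (TriPerc.nearCross n ⌊C₅ * n⌋₊) ≤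
      Real.exp (c / 4 * n) * Real.exp (-c * n) := by
    refine ((mul_le_mul_of_nonneg_right h3
      (TriPerc.Pr_nonneg hs0 (by linarith) _ _)).trans h2).trans ?_
    refine (mul_le_mul_of_nonneg_left (hdecay n) (by positivity)).trans ?_
    rw [← mul_assoc]
    exact mul_le_mul_of_nonneg_right h6 (Real.exp_pos _).le
  rw [← Real.exp_add] at h12
  have h13 := mul_le_mul_of_nonneg_left h12 (Real.exp_pos (c / 4 * n)).le
  rw [← mul_assoc, ← Real.exp_add, ← Real.exp_add, add_neg_cancel, Real.exp_zero, one_mul] at h13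
  refine h13.trans_eq ?_
  congr 1
  ring
end
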